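/- Let λ > 1, μ > 0 and ν > 0 satisfy μϱ(λ) ≤ ν. Then the set of maximizers Σ_{μ,ν,λ} is nonempty, i.e. there exists ω ∈ 𝒜_{μ,ν} with ℰ_λ(ω) = S_{μ,ν,λ}. -/

import Mathlib

open MeasureTheory Real Filter

noncomputable section

/-- The upper half plane `Π = {x ∈ ℝ² : x₂ > 0}`. -/
def UHP : Set (ℝ × ℝ) := {x | 0 < x.2}

/-- Euclidean norm of a point of `ℝ²`. -/
def rad (x : ℝ × ℝ) : ℝ := Real.sqrt (x.1 ^ 2 + x.2 ^ 2)

/-- Modified Bessel function of the second kind of order `0`: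
`K₀(r) = ∫₀^∞ exp(-r cosh t) dt`. -/
def K0 (r : ℝ) : ℝ := ∫ t in Set.Ioi (0 : ℝ), Real.exp (-(r * Real.cosh t))

/-- Fundamental solution `G(x,y) = (1/2π) K₀(|x-y|)` of `−Δ + Id` on `ℝ²`. -/
def Gker (x y : ℝ × ℝ) : ℝ := (1 / (2 * Real.pi)) * K0 (rad (x - y))

/-- Reflection `x̄ = (x₁, −x₂)` across the `x₁`-axis. -/
def reflPt (x : ℝ × ℝ) : ℝ × ℝ := (x.1, -x.2)

/-- Green's function `G_Π(x,y) = G(x,y) − G(x̄,y)` of `−Δ + Id` on the half plane. -/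
def GUHP (x y : ℝ × ℝ) : ℝ := Gker x y - Gker (reflPt x) y

/-- The operator `𝒢ω(x) = ∫_Π G_Π(x,y) ω(y) dy`. -/
def Gop (ω : ℝ × ℝ → ℝ) (x : ℝ × ℝ) : ℝ := ∫ y in UHP, GUHP x y * ω y

/-- Kinetic energy `E(ω) = (1/2) ∫_Π ω 𝒢ω`. -/
def kineticE (ω : ℝ × ℝ → ℝ) : ℝ := (1 / 2) * ∫ x in UHP, ω x * Gop ω x

/-- Impulse `I(ω) = ∫_Π x₂ ω dx`. -/
def impulse (ω : ℝ × ℝ → ℝ) : ℝ := ∫ x in UHP, x.2 * ω x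

/-- `L¹(Π)` norm. -/
def normL1 (f : ℝ × ℝ → ℝ) : ℝ := ∫ x in UHP, |f x|

/-- `L²(Π)` norm. -/
def normL2 (f : ℝ × ℝ → ℝ) : ℝ := (∫ x in UHP, (f x) ^ 2) ^ ((1 : ℝ) / 2)

/-- `L^s(Π)` norm. -/
def normLs (s : ℝ) (f : ℝ × ℝ → ℝ) : ℝ := (∫ x in UHP, |f x| ^ s) ^ (1 / s)

/-- Nonnegative member of `L¹(Π) ∩ L²(Π)`. -/
def NonnegL1L2 (ω : ℝ × ℝ → ℝ) : Prop :=
  (∀ x ∈ UHP, 0 ≤ ω x) ∧ IntegrableOn ω UHP ∧ IntegrableOn (fun x => (ω x) ^ 2) UHP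

/-- Steiner symmetry in the `x₁` variable. -/
def SteinerSym (f : ℝ × ℝ → ℝ) : Prop :=
  (∀ x : ℝ × ℝ, f (-x.1, x.2) = f x) ∧
  ∀ x₂ : ℝ, 0 < x₂ → AntitoneOn (fun x₁ => f (x₁, x₂)) (Set.Ioi (0 : ℝ))

/-- The admissible class `𝒜_{μ,ν}`. -/
def InAdm (μ ν : ℝ) (ω : ℝ × ℝ → ℝ) : Prop :=
  (∀ x ∈ UHP, 0 ≤ ω x) ∧ IntegrableOn ω UHP ∧ IntegrableOn (fun x => (ω x) ^ 2) UHP ∧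
  IntegrableOn (fun x => x.2 * ω x) UHP ∧
  impulse ω = μ ∧ (∫ x in UHP, ω x) ≤ ν

/-- The energy functional `ℰ_λ(ω) = E(ω) − (1/(2λ)) ∫_Π ω²`. -/
def Efun (lam : ℝ) (ω : ℝ × ℝ → ℝ) : ℝ :=
  kineticE ω - (1 / (2 * lam)) * ∫ x in UHP, (ω x) ^ 2

/-- The supremum `S_{μ,ν,λ} = sup_{ω ∈ 𝒜_{μ,ν}} ℰ_λ(ω)`. -/
def Sval (lam μ ν : ℝ) : ℝ := sSup {s | ∃ ω, InAdm μ ν ω ∧ s = Efun lam ω}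

/-- `ω` is a maximizer, i.e. `ω ∈ Σ_{μ,ν,λ}`. -/
def IsMaximizer (lam μ ν : ℝ) (ω : ℝ × ℝ → ℝ) : Prop :=
  InAdm μ ν ω ∧ Efun lam ω = Sval lam μ ν

/-- Bessel function of the first kind of order one. -/
def J1 (r : ℝ) : ℝ :=
  ∑' k : ℕ, ((-1 : ℝ) ^ k / ((Nat.factorial k : ℝ) * (Nat.factorial (k + 1) : ℝ))) *
    (r / 2) ^ (2 * k + 1)

/-- Modified Bessel function of the second kind of order one. -/
def K1 (r : ℝ) : ℝ := ∫ t in Set.Ioi (0 : ℝ), Real.exp (-(r * Real.cosh t)) * Real.cosh t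

/-- The set of `t > 0` with `J₁(√(λ−1) t) ≠ 0` solving the transcendental equation
`t (K₁'(t)/K₁(t) + (λ−1)^{-1/2} J₁'(√(λ−1)t)/J₁(√(λ−1)t)) = λ/(λ−1)`. -/
def aSet (lam : ℝ) : Set ℝ :=
  {t | 0 < t ∧ J1 (Real.sqrt (lam - 1) * t) ≠ 0 ∧
    t * (deriv K1 t / K1 t +
      (1 / Real.sqrt (lam - 1)) *
        (deriv J1 (Real.sqrt (lam - 1) * t) / J1 (Real.sqrt (lam - 1) * t))) = lam / (lam - 1)}

/-- The smallest positive solution `a = a(λ)`. -/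
def aLam (lam : ℝ) : ℝ := sInf (aSet lam)

/-- The stream function `Ψ_L^{λ,W}` of the Lamb dipole, written in polar coordinates
`x₁ = r cos θ`, `x₂ = r sin θ` (so that `sin θ = x₂ / r`). -/
def PsiL (lam W : ℝ) (x : ℝ × ℝ) : ℝ :=
  if rad x ≤ aLam lam then
    ((-(W * aLam lam / (lam - 1)) / J1 (Real.sqrt (lam - 1) * aLam lam)) *
        J1 (Real.sqrt (lam - 1) * rad x) + (W * lam / (lam - 1)) * rad x) * (x.2 / rad x)
  else (W * aLam lam / K1 (aLam lam)) * K1 (rad x) * (x.2 / rad x)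

/-- The Lamb dipole `ω_L^{λ,W} = λ (Ψ_L^{λ,W} − W x₂)₊` restricted to `Π`. -/
def omegaL (lam W : ℝ) (x : ℝ × ℝ) : ℝ :=
  if 0 < x.2 then lam * max (PsiL lam W x - W * x.2) 0 else 0

/-- `ϱ(λ) = (∫_Π ω_L^{λ,1} dx) / I(ω_L^{λ,1})`. -/
def varrho (lam : ℝ) : ℝ := (∫ x in UHP, omegaL lam 1 x) / impulse (omegaL lam 1)

/-- The Laplacian on `ℝ²`, written coordinatewise. -/
def lap (ψ : ℝ × ℝ → ℝ) (x : ℝ × ℝ) : ℝ :=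
  deriv (deriv fun t => ψ (t, x.2)) x.1 + deriv (deriv fun t => ψ (x.1, t)) x.2

/-- Distance (in `L¹ ∩ L²` plus weighted `L¹`) from `ζ` to a set of functions `S`. -/
def distToSet (S : Set ((ℝ × ℝ) → ℝ)) (ζ : (ℝ × ℝ) → ℝ) : ℝ :=
  sInf {d | ∃ ω ∈ S, d = normL1 (fun x => ζ x - ω x) + normL2 (fun x => ζ x - ω x) +
    normL1 (fun x => x.2 * (ζ x - ω x))}

end

open MeasureTheory Real Filter

/-! ### Basic facts about `K0` -/

lemma hx_cosh_lb (t : ℝ) : 1 + t ^ 2 / 2 ≤ Real.cosh t := by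
  have h1 : Real.cosh t = 1 + 2 * Real.sinh (t / 2) ^ 2 := by
    have h2 := Real.cosh_two_mul (t / 2)
    have h3 := Real.cosh_sq (t / 2)
    rw [show 2 * (t / 2) = t by ring] at h2
    rw [h2, h3]; ring
  have h4 : (t / 2) ^ 2 ≤ Real.sinh (t / 2) ^ 2 := by
    rcases le_total 0 (t / 2) with h | h
    · have := Real.self_le_sinh_iff.mpr h
      nlinarith
    · have := Real.sinh_le_self_iff.mpr h
      nlinarith
  rw [h1]; nlinarith

lemma hx_bd (r t : ℝ) (hr : 0 ≤ r) :
    Real.exp (-(r * Real.cosh t)) ≤ Real.exp (-r) * Real.exp (-(r / 2) * t ^ 2) := by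
  rw [← Real.exp_add]
  apply Real.exp_le_exp.mpr
  have := mul_le_mul_of_nonneg_left (hx_cosh_lb t) hr
  linarith

lemma hx_K0_int (r : ℝ) (hr : 0 < r) :
    IntegrableOn (fun t => Real.exp (-(r * Real.cosh t))) (Set.Ioi (0 : ℝ)) := by
  have h1 : Integrable (fun t : ℝ => Real.exp (-r) * Real.exp (-(r / 2) * t ^ 2)) :=
    (integrable_exp_neg_mul_sq (by linarith : 0 < r / 2)).const_mul _
  refine Integrable.mono' h1.integrableOn (by fun_prop) ?_
  refine Filter.Eventually.of_forall fun t => ?_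
  rw [Real.norm_eq_abs, abs_of_pos (Real.exp_pos _)]
  exact hx_bd r t hr.le

lemma hx_K0_nonneg (r : ℝ) : 0 ≤ K0 r := by
  unfold K0
  exact integral_nonneg fun t => (Real.exp_pos _).le

lemma hx_K0_zero : K0 0 = 0 := by
  unfold K0
  apply integral_undef
  intro h
  have h2 : IntegrableOn (fun _ : ℝ => (1 : ℝ)) (Set.Ioi (0 : ℝ)) := by
    refine (integrable_congr (Filter.Eventually.of_forall fun t => ?_)).mp h
    simp
  rw [integrableOn_const_iff] at h2
  simp at h2

/-- The explicit upper bound for `K0`. -/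
noncomputable def hxkb (r : ℝ) : ℝ := Real.exp (-r) * (Real.sqrt (π / (r / 2)) / 2)

lemma hx_K0_le (r : ℝ) (hr : 0 ≤ r) : K0 r ≤ hxkb r := by
  rcases hr.eq_or_lt with rfl | hr
  · rw [hx_K0_zero]; simp [hxkb]
  · unfold K0 hxkb
    rw [← integral_gaussian_Ioi, ← integral_const_mul]
    apply integral_mono (hx_K0_int r hr)
    · exact ((integrable_exp_neg_mul_sq (by linarith : 0 < r / 2)).const_mul _).integrableOn
    · intro t
      exact hx_bd r t hr.le

lemma hx_K0_anti {r s : ℝ} (hr : 0 < r) (hrs : r ≤ s) : K0 s ≤ K0 r := by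
  unfold K0
  apply integral_mono (hx_K0_int s (hr.trans_le hrs)) (hx_K0_int r hr)
  intro t
  apply Real.exp_le_exp.mpr
  have := mul_le_mul_of_nonneg_right hrs (Real.cosh_pos t).le
  linarith

lemma hx_K0_meas : Measurable K0 := by
  have h : StronglyMeasurable (Function.uncurry fun (r t : ℝ) => Real.exp (-(r * Real.cosh t))) := by
    apply Continuous.stronglyMeasurable
    unfold Function.uncurry
    fun_prop
  exact (h.integral_prod_right (ν := volume.restrict (Set.Ioi (0 : ℝ)))).measurable

lemma hx_exp_sqrt_convex (c : ℝ) (hc : 0 ≤ c) :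
    ConvexOn ℝ (Set.Ici (0 : ℝ)) (fun u => Real.exp (-(Real.sqrt u * c))) := by
  have h1 : ConcaveOn ℝ (Set.Ici (0 : ℝ)) Real.sqrt := Real.strictConcaveOn_sqrt.concaveOn
  have h2 : ConvexOn ℝ (Set.Ici (0 : ℝ)) (fun u => -(Real.sqrt u * c)) := by
    have := (h1.smul hc).neg
    refine this.congr ?_
    intro x _
    simp [mul_comm]
  refine ⟨convex_Ici 0, ?_⟩
  intro x hx y hy a b ha hb hab
  have h3 := h2.2 hx hy ha hb hab
  have h4 := convexOn_exp.2 (Set.mem_univ (-(Real.sqrt x * c))) (Set.mem_univ (-(Real.sqrt y * c)))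
    ha hb hab
  exact (Real.exp_le_exp.mpr h3).trans h4

/-- supermodularity of a convex function -/
lemma hx_convex_super {φ : ℝ → ℝ} (hφ : ConvexOn ℝ (Set.Ici (0 : ℝ)) φ) {p h k : ℝ}
    (hp : 0 ≤ p) (hh : 0 ≤ h) (hk : 0 ≤ k) :
    φ (p + h) + φ (p + k) ≤ φ p + φ (p + h + k) := by
  rcases (add_nonneg hh hk).eq_or_lt with h0 | h0
  · have h1 : h = 0 := by linarith
    have h2 : k = 0 := by linarith
    subst h1; subst h2; simp
  · have hP : p ∈ Set.Ici (0 : ℝ) := hp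
    have hQ : p + h + k ∈ Set.Ici (0 : ℝ) := by simp only [Set.mem_Ici]; linarith
    have e1 := hφ.2 hP hQ (by positivity : 0 ≤ k / (h + k))
      (by positivity : 0 ≤ h / (h + k))
      (by field_simp; ring)
    have e2 := hφ.2 hP hQ (by positivity : 0 ≤ h / (h + k))
      (by positivity : 0 ≤ k / (h + k))
      (by field_simp)
    simp only [smul_eq_mul] at e1 e2
    rw [show k / (h + k) * p + h / (h + k) * (p + h + k) = p + h by field_simp; ring] at e1
    rw [show h / (h + k) * p + k / (h + k) * (p + h + k) = p + k by field_simp; ring] at e2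
    have e3 : k / (h + k) + h / (h + k) = 1 := by field_simp; ring
    have : φ p + φ (p + h + k) = (k / (h + k) + h / (h + k)) * φ p
        + (k / (h + k) + h / (h + k)) * φ (p + h + k) := by rw [e3]; ring
    rw [this]; linarith

lemma hx_K0_super {p h k : ℝ} (hp : 0 < p) (hh : 0 ≤ h) (hk : 0 ≤ k) :
    K0 (Real.sqrt (p + h)) + K0 (Real.sqrt (p + k)) ≤ K0 (Real.sqrt p) + K0 (Real.sqrt (p + h + k)) := by
  have i1 := hx_K0_int _ (Real.sqrt_pos.mpr (by linarith : 0 < p + h))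
  have i2 := hx_K0_int _ (Real.sqrt_pos.mpr (by linarith : 0 < p + k))
  have i3 := hx_K0_int _ (Real.sqrt_pos.mpr hp)
  have i4 := hx_K0_int _ (Real.sqrt_pos.mpr (by linarith : 0 < p + h + k))
  unfold K0
  rw [← integral_add i1 i2, ← integral_add i3 i4]
  apply integral_mono (i1.add i2) (i3.add i4)
  intro t
  exact hx_convex_super (hx_exp_sqrt_convex (Real.cosh t) (Real.cosh_pos t).le) hp.le hh hk

open MeasureTheory Real Filter

lemma hx_rad_meas : Measurable rad := by
  unfold rad; fun_prop

lemma hx_rad_neg (z : ℝ × ℝ) : rad (-z) = rad z := by simp [rad]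

lemma hx_rad_nonneg (z : ℝ × ℝ) : 0 ≤ rad z := Real.sqrt_nonneg _

lemma hx_abs_fst_le (z : ℝ × ℝ) : |z.1| ≤ rad z := by
  unfold rad
  apply Real.le_sqrt_of_sq_le
  rw [sq_abs]; nlinarith [sq_nonneg z.2]

lemma hx_abs_snd_le (z : ℝ × ℝ) : |z.2| ≤ rad z := by
  unfold rad
  apply Real.le_sqrt_of_sq_le
  rw [sq_abs]; nlinarith [sq_nonneg z.1]

lemma hx_polar (F : ℝ → ENNReal) (hF : Measurable F) :
    ∫⁻ z : ℝ × ℝ, F (rad z) =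
      ENNReal.ofReal (2 * π) * ∫⁻ r in Set.Ioi (0 : ℝ), ENNReal.ofReal r * F r := by
  rw [← lintegral_comp_polarCoord_symm]
  have h0 : polarCoord.target = Set.Ioi (0 : ℝ) ×ˢ Set.Ioo (-π) π := rfl
  have h1 : ∫⁻ (p : ℝ × ℝ) in polarCoord.target, ENNReal.ofReal p.1 • F (rad (polarCoord.symm p))
      = ∫⁻ (p : ℝ × ℝ) in polarCoord.target, (ENNReal.ofReal p.1 * F p.1) * 1 := by
    refine setLIntegral_congr_fun polarCoord.open_target.measurableSet (fun p hp => ?_)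
    have hp1 : 0 < p.1 := hp.1
    have : rad (polarCoord.symm p) = p.1 := by
      simp only [polarCoord_symm_apply, rad]
      rw [show (p.1 * Real.cos p.2) ^ 2 + (p.1 * Real.sin p.2) ^ 2 = p.1 ^ 2 by
        nlinarith [Real.sin_sq_add_cos_sq p.2]]
      exact Real.sqrt_sq hp1.le
    simp only [this, smul_eq_mul, mul_one]
  rw [h1, h0, Measure.volume_eq_prod, ← Measure.prod_restrict]
  rw [lintegral_prod_mul (f := fun r => ENNReal.ofReal r * F r) (g := fun _ => 1)
    (by fun_prop) (by fun_prop)]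
  rw [lintegral_one, Measure.restrict_apply_univ, Real.volume_Ioo, mul_comm]
  congr 2; ring

lemma hx_tanh_tendsto : Tendsto (fun t : ℝ => Real.sinh t / Real.cosh t) atTop (nhds 1) := by
  have h1 : ∀ t : ℝ, Real.sinh t / Real.cosh t = 1 - Real.exp (-t) / Real.cosh t := by
    intro t
    have := (Real.cosh_pos t).ne'
    field_simp
    rw [Real.sinh_eq, Real.cosh_eq]; ring
  have h2 : Tendsto (fun t : ℝ => Real.exp (-t) / Real.cosh t) atTop (nhds 0) := by
    refine squeeze_zero (fun t => div_nonneg (Real.exp_pos _).le (Real.cosh_pos t).le)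
      (fun t => div_le_self (Real.exp_pos _).le (Real.one_le_cosh t)) ?_
    exact Real.tendsto_exp_neg_atTop_nhds_zero
  simp_rw [h1]
  simpa using h2.const_sub 1

lemma hx_sech : ∫⁻ t in Set.Ioi (0 : ℝ), ENNReal.ofReal (1 / Real.cosh t ^ 2) = 1 := by
  have hd : ∀ x ∈ Set.Ici (0 : ℝ),
      HasDerivAt (fun t => Real.sinh t / Real.cosh t) (1 / Real.cosh x ^ 2) x := by
    intro x _
    have := (Real.hasDerivAt_sinh x).div (Real.hasDerivAt_cosh x) (Real.cosh_pos x).ne'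
    refine this.congr_deriv ?_
    congr 1
    have := Real.cosh_sq x
    nlinarith
  have hp : ∀ x ∈ Set.Ioi (0 : ℝ), 0 ≤ 1 / Real.cosh x ^ 2 := fun x _ => by positivity
  rw [← ofReal_integral_eq_lintegral_ofReal
    (integrableOn_Ioi_deriv_of_nonneg' hd hp hx_tanh_tendsto)
    (Filter.Eventually.of_forall fun x => by positivity)]
  rw [integral_Ioi_of_hasDerivAt_of_nonneg' hd hp hx_tanh_tendsto]
  simp

lemma hx_K0_ofReal (r : ℝ) (hr : 0 < r) :
    ENNReal.ofReal (K0 r) = ∫⁻ t in Set.Ioi (0 : ℝ), ENNReal.ofReal (Real.exp (-(r * Real.cosh t))) := by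
  unfold K0
  exact ofReal_integral_eq_lintegral_ofReal (hx_K0_int r hr)
    (Filter.Eventually.of_forall fun x => (Real.exp_pos _).le)

lemma hx_rexp (b : ℝ) (hb : 0 < b) :
    ∫⁻ r in Set.Ioi (0 : ℝ), ENNReal.ofReal (r * Real.exp (-(r * b))) = ENNReal.ofReal (1 / b ^ 2) := by
  have h1 := Real.integral_rpow_mul_exp_neg_mul_Ioi (a := 2) (r := b) (by norm_num) hb
  have h2 : ∫ r in Set.Ioi (0 : ℝ), r * Real.exp (-(r * b)) = 1 / b ^ 2 := by
    have e : (1 / b) ^ (2 : ℝ) * Real.Gamma 2 = 1 / b ^ 2 := by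
      rw [Real.Gamma_two, mul_one, show (2 : ℝ) = ((2 : ℕ) : ℝ) by norm_num, Real.rpow_natCast]
      simp
    rw [← e, ← h1]
    apply setIntegral_congr_fun measurableSet_Ioi
    intro r _
    simp only
    rw [show (2 : ℝ) - 1 = 1 by norm_num, Real.rpow_one, mul_comm b r]
  rw [← h2]
  symm
  apply ofReal_integral_eq_lintegral_ofReal
  · by_contra hc
    have := integral_undef hc
    rw [h2] at this
    have : 0 < 1 / b ^ 2 := by positivity
    linarith
  · filter_upwards [ae_restrict_mem measurableSet_Ioi] with r hr
    have : (0 : ℝ) < r := hr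
    positivity

lemma hx_total_lint : ∫⁻ z : ℝ × ℝ, ENNReal.ofReal (K0 (rad z)) = ENNReal.ofReal (2 * π) := by
  rw [hx_polar (fun r => ENNReal.ofReal (K0 r)) (hx_K0_meas.ennreal_ofReal)]
  have h1 : ∫⁻ r in Set.Ioi (0 : ℝ), ENNReal.ofReal r * ENNReal.ofReal (K0 r) =
      ∫⁻ r in Set.Ioi (0 : ℝ), ∫⁻ t in Set.Ioi (0 : ℝ),
        ENNReal.ofReal (r * Real.exp (-(r * Real.cosh t))) := by
    refine setLIntegral_congr_fun measurableSet_Ioi (fun r hr => ?_)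
    have hr : (0 : ℝ) < r := hr
    rw [hx_K0_ofReal r hr, ← lintegral_const_mul _ (by fun_prop)]
    simp_rw [ENNReal.ofReal_mul hr.le]
  rw [h1, lintegral_lintegral_swap (by unfold Function.uncurry; fun_prop)]
  simp_rw [hx_rexp _ (Real.cosh_pos _)]
  rw [hx_sech, mul_one]

lemma hx_total_int : Integrable (fun z : ℝ × ℝ => K0 (rad z)) := by
  refine ⟨(hx_K0_meas.comp hx_rad_meas).aestronglyMeasurable, ?_⟩
  rw [hasFiniteIntegral_iff_ofReal (Filter.Eventually.of_forall fun z => hx_K0_nonneg _), hx_total_lint]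
  exact ENNReal.ofReal_lt_top

lemma hx_total : ∫ z : ℝ × ℝ, K0 (rad z) = 2 * π := by
  rw [integral_eq_lintegral_of_nonneg_ae (Filter.Eventually.of_forall fun z => hx_K0_nonneg _)
    (hx_K0_meas.comp hx_rad_meas).aestronglyMeasurable, hx_total_lint, ENNReal.toReal_ofReal]
  positivity

lemma hx_sq_int : Integrable (fun z : ℝ × ℝ => K0 (rad z) ^ 2) := by
  refine ⟨((hx_K0_meas.comp hx_rad_meas).pow_const 2).aestronglyMeasurable, ?_⟩
  rw [hasFiniteIntegral_iff_ofReal (Filter.Eventually.of_forall fun z => sq_nonneg _)]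
  rw [hx_polar (fun r => ENNReal.ofReal (K0 r ^ 2)) ((hx_K0_meas.pow_const 2).ennreal_ofReal)]
  apply ENNReal.mul_lt_top ENNReal.ofReal_lt_top
  have h1 : Integrable (fun r : ℝ => (π / 2) * Real.exp (-2 * r)) (volume.restrict (Set.Ioi 0)) :=
    (integrableOn_exp_mul_Ioi (by norm_num) 0).const_mul _
  refine lt_of_le_of_lt ?_ h1.lintegral_lt_top
  refine setLIntegral_mono' measurableSet_Ioi (fun r hr => ?_)
  have hr : (0 : ℝ) < r := hr
  rw [← ENNReal.ofReal_mul hr.le]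
  apply ENNReal.ofReal_le_ofReal
  have h2 : K0 r ^ 2 ≤ hxkb r ^ 2 := pow_le_pow_left₀ (hx_K0_nonneg r) (hx_K0_le r hr.le) 2
  have h3 : hxkb r ^ 2 = Real.exp (-2 * r) * (π / (2 * r)) := by
    unfold hxkb
    rw [mul_pow, div_pow, Real.sq_sqrt (by positivity), ← Real.exp_nat_mul]
    congr 1
    · congr 1; push_cast; ring
    · field_simp
  calc r * K0 r ^ 2 ≤ r * (Real.exp (-2 * r) * (π / (2 * r))) := by
        rw [← h3]; exact mul_le_mul_of_nonneg_left h2 hr.le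
    _ = _ := by field_simp

lemma hx_line_int : Integrable (fun s : ℝ => K0 |s|) := by
  have hpos : IntegrableOn (fun s : ℝ => K0 |s|) (Set.Ioi 0) := by
    have hg := (Real.GammaIntegral_convergent (s := 1 / 2) (by norm_num)).const_mul
      (Real.sqrt (2 * π) / 2)
    refine Integrable.mono' hg (hx_K0_meas.comp measurable_norm).aestronglyMeasurable ?_
    filter_upwards [ae_restrict_mem measurableSet_Ioi] with r hr
    have hr : (0 : ℝ) < r := hr
    rw [Real.norm_eq_abs, abs_of_nonneg (hx_K0_nonneg _), abs_of_pos hr]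
    refine (hx_K0_le r hr.le).trans (le_of_eq ?_)
    unfold hxkb
    have : Real.sqrt (π / (r / 2)) = Real.sqrt (2 * π) * r ^ ((1 : ℝ) / 2 - 1) := by
      rw [show π / (r / 2) = (2 * π) / r by field_simp, Real.sqrt_div' _ hr.le,
        show (1 : ℝ) / 2 - 1 = - (1 / 2) by norm_num, Real.rpow_neg hr.le, ← Real.sqrt_eq_rpow,
        div_eq_mul_inv]
    rw [this]; ring
  rw [← integrableOn_univ, ← Set.Iic_union_Ioi (a := (0 : ℝ)), integrableOn_union]
  refine ⟨?_, hpos⟩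
  rw [integrableOn_Iic_iff_integrableOn_Iio]
  have := (Measure.measurePreserving_neg (volume : Measure ℝ)).integrableOn_comp_preimage
    (Homeomorph.neg ℝ).measurableEmbedding (f := fun s : ℝ => K0 |s|) (s := Set.Ioi 0)
  have h2 := this.mpr hpos
  simpa [Function.comp_def] using h2

lemma hx_K0_tendsto : Tendsto K0 atTop (nhds 0) := by
  refine squeeze_zero' (Filter.Eventually.of_forall hx_K0_nonneg)
    (g := fun r => Real.sqrt (2 * π) * Real.exp (-r)) ?_ ?_
  · filter_upwards [eventually_ge_atTop 1] with r hr
    refine (hx_K0_le r (by linarith)).trans ?_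
    unfold hxkb
    rw [mul_comm]
    refine mul_le_mul_of_nonneg_right ?_ (Real.exp_pos _).le
    have h1 : Real.sqrt (π / (r / 2)) ≤ Real.sqrt (2 * π) := by
      apply Real.sqrt_le_sqrt
      rw [div_le_iff₀ (by linarith)]
      nlinarith [Real.pi_pos]
    have := Real.sqrt_nonneg (π / (r / 2))
    linarith
  · simpa using Real.tendsto_exp_neg_atTop_nhds_zero.const_mul (Real.sqrt (2 * π))

open MeasureTheory Real Filter

/-! ### The kernel on the half plane -/

/-- Lebesgue measure on the half plane. -/
noncomputable abbrev vP : Measure (ℝ × ℝ) := volume.restrict UHP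

lemma hx_UHP_meas : MeasurableSet UHP := measurableSet_lt measurable_const measurable_snd

lemma hx_UHP_prod : UHP = Set.univ ×ˢ Set.Ioi (0 : ℝ) := by
  ext x; simp [UHP]

lemma hx_vP_prod : vP = (volume : Measure ℝ).prod (volume.restrict (Set.Ioi (0 : ℝ))) := by
  unfold vP
  rw [hx_UHP_prod, Measure.volume_eq_prod, ← Measure.prod_restrict, Measure.restrict_univ]

lemma hx_mem : ∀ᵐ x ∂vP, x ∈ UHP := ae_restrict_mem hx_UHP_meas

lemma hx_ne (x : ℝ × ℝ) : ∀ᵐ y ∂vP, y ≠ x := by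
  apply ae_restrict_of_ae
  simp [ae_iff]

lemma hx_Gker_meas : Measurable (fun p : (ℝ × ℝ) × (ℝ × ℝ) => Gker p.1 p.2) := by
  unfold Gker
  exact ((hx_K0_meas.comp (hx_rad_meas.comp (by fun_prop))).const_mul _)

lemma hx_refl_meas : Measurable reflPt := by unfold reflPt; fun_prop

lemma hx_GUHP_meas : Measurable (fun p : (ℝ × ℝ) × (ℝ × ℝ) => GUHP p.1 p.2) := by
  unfold GUHP
  exact hx_Gker_meas.sub (hx_Gker_meas.comp
    ((hx_refl_meas.comp measurable_fst).prodMk measurable_snd))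

lemma hx_GUHP_meas' (x : ℝ × ℝ) : Measurable (fun y => GUHP x y) :=
  by
  have h := hx_GUHP_meas.comp (measurable_prodMk_left (x := x))
  exact h

lemma hx_Gker_meas' (x : ℝ × ℝ) : Measurable (fun y => Gker x y) :=
  by
  have h := hx_Gker_meas.comp (measurable_prodMk_left (x := x))
  exact h

lemma hx_c_pos : 0 < 1 / (2 * π) := by positivity

lemma hx_Gker_nonneg (x y : ℝ × ℝ) : 0 ≤ Gker x y :=
  mul_nonneg hx_c_pos.le (hx_K0_nonneg _)

lemma hx_GUHP_le (x y : ℝ × ℝ) : GUHP x y ≤ Gker x y := by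
  unfold GUHP; linarith [hx_Gker_nonneg (reflPt x) y]

lemma hx_rad_refl {x y : ℝ × ℝ} (hx : x ∈ UHP) (hy : y ∈ UHP) :
    rad (x - y) ≤ rad (reflPt x - y) := by
  have hx : 0 < x.2 := hx
  have hy : 0 < y.2 := hy
  unfold rad reflPt
  apply Real.sqrt_le_sqrt
  simp only [Prod.fst_sub, Prod.snd_sub]
  nlinarith [mul_pos hx hy]

lemma hx_rad_pos {z : ℝ × ℝ} (hz : z ≠ 0) : 0 < rad z := by
  rcases (hx_rad_nonneg z).eq_or_lt with h | h
  · exfalso; apply hz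
    have h1 := hx_abs_fst_le z
    have h2 := hx_abs_snd_le z
    rw [← h] at h1 h2
    exact Prod.ext (abs_nonpos_iff.mp h1) (abs_nonpos_iff.mp h2)
  · exact h

lemma hx_GUHP_nonneg {x y : ℝ × ℝ} (hx : x ∈ UHP) (hy : y ∈ UHP) (h : y ≠ x) : 0 ≤ GUHP x y := by
  unfold GUHP Gker
  rw [← mul_sub]
  apply mul_nonneg hx_c_pos.le
  have := hx_K0_anti (hx_rad_pos (sub_ne_zero.mpr h.symm)) (hx_rad_refl hx hy)
  linarith

lemma hx_Gker_eq (x y : ℝ × ℝ) : Gker x y = (1 / (2 * π)) * K0 (rad (x - y)) := rfl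

/-- `∫ G²` -/
noncomputable def hxC2 : ℝ := ∫ z : ℝ × ℝ, ((1 / (2 * π)) * K0 (rad z)) ^ 2

lemma hx_C2_nonneg : 0 ≤ hxC2 := integral_nonneg fun _ => sq_nonneg _

lemma hx_Gsq_int0 : Integrable (fun z : ℝ × ℝ => ((1 / (2 * π)) * K0 (rad z)) ^ 2) := by
  simp_rw [mul_pow]
  exact hx_sq_int.const_mul _

lemma hx_Gsq_int (x : ℝ × ℝ) : Integrable (fun y => Gker x y ^ 2) :=
  hx_Gsq_int0.comp_sub_left x

lemma hx_Gsq (x : ℝ × ℝ) : ∫ y, Gker x y ^ 2 = hxC2 :=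
  integral_sub_left_eq_self (fun z : ℝ × ℝ => ((1 / (2 * π)) * K0 (rad z)) ^ 2) volume x

lemma hx_G_int (x : ℝ × ℝ) : Integrable (fun y => Gker x y) :=
  (hx_total_int.const_mul (1 / (2 * π))).comp_sub_left x

lemma hx_ae_GUHP {x : ℝ × ℝ} (hx : x ∈ UHP) : ∀ᵐ y ∂vP, 0 ≤ GUHP x y ∧ GUHP x y ≤ Gker x y := by
  filter_upwards [hx_mem, hx_ne x] with y hy hne
  exact ⟨hx_GUHP_nonneg hx hy hne, hx_GUHP_le x y⟩

lemma hx_GU_sq_int {x : ℝ × ℝ} (hx : x ∈ UHP) : Integrable (fun y => GUHP x y ^ 2) vP := by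
  refine Integrable.mono' ((hx_Gsq_int x).restrict) ((hx_GUHP_meas' x).pow_const 2).aestronglyMeasurable ?_
  filter_upwards [hx_ae_GUHP hx] with y hy
  rw [Real.norm_eq_abs, abs_of_nonneg (sq_nonneg _)]
  exact pow_le_pow_left₀ hy.1 hy.2 2

lemma hx_GU_sq_le {x : ℝ × ℝ} (hx : x ∈ UHP) : ∫ y, GUHP x y ^ 2 ∂vP ≤ hxC2 := by
  rw [← hx_Gsq x]
  calc ∫ y, GUHP x y ^ 2 ∂vP ≤ ∫ y, Gker x y ^ 2 ∂vP := by
        apply integral_mono_ae (hx_GU_sq_int hx) (hx_Gsq_int x).restrict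
        filter_upwards [hx_ae_GUHP hx] with y hy
        exact pow_le_pow_left₀ hy.1 hy.2 2
    _ ≤ _ := setIntegral_le_integral (hx_Gsq_int x) (Filter.Eventually.of_forall fun _ => sq_nonneg _)

/-- nonnegative functions in `L¹ ∩ L²` with finite impulse -/
structure Fn (f : ℝ × ℝ → ℝ) : Prop where
  nn : ∀ x, 0 ≤ f x
  i1 : Integrable f vP
  i2 : Integrable (fun x => f x ^ 2) vP

lemma Fn.ms {f : ℝ × ℝ → ℝ} (hf : Fn f) : AEStronglyMeasurable f vP := hf.i1.1

lemma hx_Gf_int {f : ℝ × ℝ → ℝ} (hf : Fn f) {x : ℝ × ℝ} (hx : x ∈ UHP) :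
    Integrable (fun y => GUHP x y * f y) vP := by
  refine Integrable.mono' (((hx_GU_sq_int hx).add hf.i2))
    ((hx_GUHP_meas' x).aestronglyMeasurable.mul hf.ms) ?_
  refine Filter.Eventually.of_forall fun y => ?_
  rw [Real.norm_eq_abs]
  simp only [Pi.add_apply]
  rw [abs_le]
  constructor <;> nlinarith [sq_nonneg (GUHP x y + f y), sq_nonneg (GUHP x y - f y),
    sq_nonneg (GUHP x y), sq_nonneg (f y)]

lemma hx_Gop_nonneg {f : ℝ × ℝ → ℝ} (hf : Fn f) {x : ℝ × ℝ} (hx : x ∈ UHP) : 0 ≤ Gop f x := by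
  apply integral_nonneg_of_ae
  filter_upwards [hx_ae_GUHP hx] with y hy
  exact mul_nonneg hy.1 (hf.nn y)

lemma hx_Gop_le {f : ℝ × ℝ → ℝ} (hf : Fn f) {x : ℝ × ℝ} (hx : x ∈ UHP) {t : ℝ} (ht : 0 < t) :
    Gop f x ≤ (t * hxC2 + (∫ y, f y ^ 2 ∂vP) / t) / 2 := by
  have h1 : Gop f x ≤ ∫ y, (t / 2 * GUHP x y ^ 2 + (1 / (2 * t)) * f y ^ 2) ∂vP := by
    apply integral_mono (hx_Gf_int hf hx)
    · exact ((hx_GU_sq_int hx).const_mul _).add (hf.i2.const_mul _)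
    · intro y
      simp only
      have : t / 2 * GUHP x y ^ 2 + (1 / (2 * t)) * f y ^ 2 - GUHP x y * f y
        = (1 / (2 * t)) * (t * GUHP x y - f y) ^ 2 := by field_simp; ring
      have h2 : 0 ≤ (1 / (2 * t)) * (t * GUHP x y - f y) ^ 2 := by positivity
      linarith
  rw [integral_add ((hx_GU_sq_int hx).const_mul _) (hf.i2.const_mul _), integral_const_mul,
    integral_const_mul] at h1
  have h2 := mul_le_mul_of_nonneg_left (hx_GU_sq_le hx) (by positivity : 0 ≤ t / 2)
  calc Gop f x ≤ _ := h1
    _ ≤ t / 2 * hxC2 + 1 / (2 * t) * ∫ y, f y ^ 2 ∂vP := by linarith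
    _ = _ := by field_simp

/-- integrand of the energy -/
noncomputable def hxP (f : ℝ × ℝ → ℝ) (p : (ℝ × ℝ) × (ℝ × ℝ)) : ℝ := f p.1 * (GUHP p.1 p.2 * f p.2)

lemma hx_P_ms {f : ℝ × ℝ → ℝ} (hf : Fn f) : AEStronglyMeasurable (hxP f) (vP.prod vP) := by
  unfold hxP
  exact (hf.ms.comp_fst).mul (hx_GUHP_meas.aestronglyMeasurable.mul (hf.ms.comp_snd))

lemma hx_Gop_ms {f : ℝ × ℝ → ℝ} (hf : Fn f) : AEStronglyMeasurable (Gop f) vP := by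
  have : AEStronglyMeasurable (fun p : (ℝ × ℝ) × (ℝ × ℝ) => GUHP p.1 p.2 * f p.2) (vP.prod vP) :=
    hx_GUHP_meas.aestronglyMeasurable.mul (hf.ms.comp_snd)
  exact this.integral_prod_right'

lemma hx_fG_int {f : ℝ × ℝ → ℝ} (hf : Fn f) : Integrable (fun x => f x * Gop f x) vP := by
  refine Integrable.mono' (hf.i1.mul_const ((1 * hxC2 + (∫ y, f y ^ 2 ∂vP) / 1) / 2))
    (hf.ms.mul (hx_Gop_ms hf)) ?_
  filter_upwards [hx_mem] with x hx
  rw [Real.norm_eq_abs, abs_of_nonneg (mul_nonneg (hf.nn x) (hx_Gop_nonneg hf hx))]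
  exact mul_le_mul_of_nonneg_left (hx_Gop_le hf hx one_pos) (hf.nn x)

lemma hx_P_int {f : ℝ × ℝ → ℝ} (hf : Fn f) : Integrable (hxP f) (vP.prod vP) := by
  rw [integrable_prod_iff (hx_P_ms hf)]
  constructor
  · filter_upwards [hx_mem] with x hx
    have h := (hx_Gf_int hf hx).const_mul (f x)
    exact h
  · refine (hx_fG_int hf).congr ?_
    filter_upwards [hx_mem] with x hx
    unfold Gop
    rw [← integral_const_mul]
    apply integral_congr_ae
    filter_upwards [hx_ae_GUHP hx] with y hy
    rw [Real.norm_eq_abs]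
    exact (abs_of_nonneg (mul_nonneg (hf.nn x) (mul_nonneg hy.1 (hf.nn y)))).symm

lemma hx_E_eq {f : ℝ × ℝ → ℝ} (hf : Fn f) : kineticE f = (1 / 2) * ∫ p, hxP f p ∂(vP.prod vP) := by
  unfold kineticE
  rw [integral_prod _ (hx_P_int hf)]
  congr 1
  apply integral_congr_ae
  refine Filter.Eventually.of_forall fun x => ?_
  simp only [hxP, Gop]
  rw [integral_const_mul]

/-- coercivity of the energy -/
lemma hx_E_le {f : ℝ × ℝ → ℝ} (hf : Fn f) {t : ℝ} (ht : 0 < t) {ν : ℝ} (hν : ∫ x, f x ∂vP ≤ ν) :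
    kineticE f ≤ ν * (t * hxC2 + (∫ y, f y ^ 2 ∂vP) / t) / 4 := by
  have h0 : 0 ≤ ∫ y, f y ^ 2 ∂vP := integral_nonneg fun _ => sq_nonneg _
  have hB : 0 ≤ (t * hxC2 + (∫ y, f y ^ 2 ∂vP) / t) / 2 := by
    have := hx_C2_nonneg
    positivity
  have h1 : ∫ x, f x * Gop f x ∂vP ≤ ∫ x, f x * ((t * hxC2 + (∫ y, f y ^ 2 ∂vP) / t) / 2) ∂vP := by
    apply integral_mono_ae (hx_fG_int hf) (hf.i1.mul_const _)
    filter_upwards [hx_mem] with x hx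
    exact mul_le_mul_of_nonneg_left (hx_Gop_le hf hx ht) (hf.nn x)
  rw [integral_mul_const] at h1
  have h2 := mul_le_mul_of_nonneg_right hν hB
  unfold kineticE
  linarith

lemma hx_Efun_le {f : ℝ × ℝ → ℝ} (hf : Fn f) {lam ν : ℝ} (hl : 0 < lam) (hν : 0 < ν)
    (hm : ∫ x, f x ∂vP ≤ ν) :
    Efun lam f ≤ ν ^ 2 * lam * hxC2 / 4 - (1 / (4 * lam)) * ∫ x, f x ^ 2 ∂vP := by
  have h := hx_E_le hf (by positivity : 0 < ν * lam) hm
  unfold Efun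
  have e : ν * (ν * lam * hxC2 + (∫ y, f y ^ 2 ∂vP) / (ν * lam)) / 4 =
    ν ^ 2 * lam * hxC2 / 4 + (1 / (4 * lam)) * ∫ x, f x ^ 2 ∂vP := by field_simp
  have e2 : (1 / (2 * lam)) * ∫ x, f x ^ 2 ∂vP = 2 * ((1 / (4 * lam)) * ∫ x, f x ^ 2 ∂vP) := by
    field_simp; ring
  rw [e2]
  linarith

open MeasureTheory Real Filter

/-! ### Weak compactness in `L²(Π)` -/

lemma hx_memLp {f : ℝ × ℝ → ℝ} (hf : Fn f) : MemLp f 2 vP :=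
  (memLp_two_iff_integrable_sq hf.ms).mpr hf.i2

lemma hx_weak {f : ℕ → ℝ × ℝ → ℝ} (hf : ∀ n, Fn (f n)) {M : ℝ}
    (hM : ∀ n, ∫ x, f n x ^ 2 ∂vP ≤ M) :
    ∃ φ : ℕ → ℕ, StrictMono φ ∧ ∃ g : ℝ × ℝ → ℝ, (∀ x, 0 ≤ g x) ∧ MemLp g 2 vP ∧
      ∀ h, MemLp h 2 vP →
        Tendsto (fun n => ∫ x, f (φ n) x * h x ∂vP) atTop (nhds (∫ x, g x * h x ∂vP)) := by
  have inn : ∀ u v : Lp ℝ 2 vP, inner ℝ u v = ∫ x, u x * v x ∂vP := by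
    intro u v
    rw [L2.inner_def]
    apply integral_congr_ae
    refine Filter.Eventually.of_forall fun x => ?_
    simp [mul_comm]
  let u : ℕ → Lp ℝ 2 vP := fun n => (hx_memLp (hf n)).toLp (f n)
  have hu : ∀ n, ‖u n‖ ≤ Real.sqrt M := by
    intro n
    apply Real.le_sqrt_of_sq_le
    rw [← real_inner_self_eq_norm_sq, inn]
    refine le_trans (le_of_eq ?_) (hM n)
    apply integral_congr_ae
    filter_upwards [(hx_memLp (hf n)).coeFn_toLp] with x hx
    simp only [u]
    rw [hx]; ring
  let T : ℕ → WeakDual ℝ (Lp ℝ 2 vP) := fun n =>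
    StrongDual.toWeakDual (InnerProductSpace.toDual ℝ (Lp ℝ 2 vP) (u n))
  have hT : ∀ n, T n ∈ WeakDual.toStrongDual ⁻¹'
      Metric.closedBall (0 : StrongDual ℝ (Lp ℝ 2 vP)) (Real.sqrt M) := by
    intro n
    simp only [Set.mem_preimage, Metric.mem_closedBall, dist_zero_right]
    have : WeakDual.toStrongDual (T n) = InnerProductSpace.toDual ℝ (Lp ℝ 2 vP) (u n) := rfl
    rw [this, LinearIsometryEquiv.norm_map]
    exact hu n
  have : Fact ((1 : ENNReal) ≤ 2) := ⟨by norm_num⟩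
  have : Fact ((2 : ENNReal) ≠ ⊤) := ⟨by norm_num⟩
  obtain ⟨T', -, φ, hφ, hlim⟩ := WeakDual.isSeqCompact_closedBall ℝ (Lp ℝ 2 vP) 0 (Real.sqrt M) hT
  let v : Lp ℝ 2 vP := (InnerProductSpace.toDual ℝ (Lp ℝ 2 vP)).symm (WeakDual.toStrongDual T')
  have hv : ∀ h : Lp ℝ 2 vP, inner ℝ v h = T' h := by
    intro h
    exact InnerProductSpace.toDual_symm_apply
  have hconv : ∀ h, MemLp h 2 vP →
        Tendsto (fun n => ∫ x, f (φ n) x * h x ∂vP) atTop (nhds (∫ x, v x * h x ∂vP)) := by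
    intro h hh
    have h1 : Tendsto (fun n => (T (φ n)) (hh.toLp h)) atTop (nhds (T' (hh.toLp h))) :=
      ((WeakDual.eval_continuous (hh.toLp h)).tendsto T').comp hlim
    rw [← hv, inn] at h1
    have e1 : ∫ x, v x * (hh.toLp h) x ∂vP = ∫ x, v x * h x ∂vP := by
      apply integral_congr_ae
      filter_upwards [hh.coeFn_toLp] with x hx
      rw [hx]
    rw [e1] at h1
    refine h1.congr fun n => ?_
    have : T (φ n) (hh.toLp h) = inner ℝ (u (φ n)) (hh.toLp h) := rfl
    rw [this, inn]
    apply integral_congr_ae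
    filter_upwards [hh.coeFn_toLp, (hx_memLp (hf (φ n))).coeFn_toLp] with x hx hx2
    simp only [u]
    rw [hx, hx2]
  have hvm : MemLp v 2 vP := Lp.memLp v
  have hvnn : 0 ≤ᵐ[vP] v := by
    apply ae_nonneg_of_forall_setIntegral_nonneg_of_sigmaFinite
    · intro s hs hfin
      have hm' : MemLp (v : ℝ × ℝ → ℝ) 2 (vP.restrict s) := hvm.restrict s
      have : IsFiniteMeasure (vP.restrict s) := ⟨by simpa using hfin⟩
      exact hm'.integrable (by norm_num)
    · intro s hs hfin
      have hind : MemLp (s.indicator fun _ => (1 : ℝ)) 2 vP :=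
        memLp_indicator_const 2 hs 1 (Or.inr hfin.ne)
      have h1 := hconv _ hind
      have e : ∫ x, v x * s.indicator (fun _ => (1 : ℝ)) x ∂vP = ∫ x in s, v x ∂vP := by
        rw [← integral_indicator hs]
        congr 1; ext x
        by_cases hx : x ∈ s <;> simp [hx]
      rw [e] at h1
      refine ge_of_tendsto' h1 fun n => ?_
      apply integral_nonneg
      intro x
      exact mul_nonneg ((hf _).nn x) (Set.indicator_nonneg (fun _ _ => zero_le_one) x)
  have hae : (fun x => max (v x) 0) =ᵐ[vP] v := by
    filter_upwards [hvnn] with x hx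
    exact max_eq_left hx
  refine ⟨φ, hφ, fun x => max (v x) 0, fun x => le_max_right _ _, hvm.ae_eq hae.symm, ?_⟩
  intro h hh
  have e : ∫ x, max (v x) 0 * h x ∂vP = ∫ x, v x * h x ∂vP := by
    apply integral_congr_ae
    filter_upwards [hae] with x hx
    rw [hx]
  rw [e]
  exact hconv h hh

lemma hx_weight {F : ℕ → ℝ × ℝ → ℝ} (hF : ∀ n, Fn (F n)) {g : ℝ × ℝ → ℝ} (hg : ∀ x, 0 ≤ g x)
    (hg2 : MemLp g 2 vP)
    (W : ∀ h, MemLp h 2 vP →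
        Tendsto (fun n => ∫ x, F n x * h x ∂vP) atTop (nhds (∫ x, g x * h x ∂vP)))
    {w : ℝ × ℝ → ℝ} (hw : Measurable w) (hwn : ∀ x ∈ UHP, 0 ≤ w x)
    (hi : ∀ n, Integrable (fun x => w x * F n x) vP) {B : ℝ}
    (hB : ∀ᶠ n in atTop, ∫ x, w x * F n x ∂vP ≤ B) :
    Integrable (fun x => w x * g x) vP ∧ ∫ x, w x * g x ∂vP ≤ B := by
  let S : ℕ → Set (ℝ × ℝ) := fun N => Metric.closedBall 0 N ∩ {x | |w x| ≤ N}
  have hS : ∀ N, MeasurableSet (S N) := fun N =>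
    measurableSet_closedBall.inter (measurableSet_le hw.abs measurable_const)
  have hSf : ∀ N, vP (S N) ≠ ⊤ := by
    intro N
    refine ne_top_of_le_ne_top (measure_closedBall_lt_top (μ := vP) (x := (0 : ℝ × ℝ)) (r := N)).ne ?_
    exact measure_mono Set.inter_subset_left
  let wN : ℕ → ℝ × ℝ → ℝ := fun N => (S N).indicator w
  have hwN : ∀ N, MemLp (wN N) 2 vP := by
    intro N
    have h1 : MemLp ((S N).indicator fun _ => (N : ℝ)) 2 vP :=
      memLp_indicator_const 2 (hS N) _ (Or.inr (hSf N))
    refine h1.mono (hw.indicator (hS N)).aestronglyMeasurable ?_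
    refine Filter.Eventually.of_forall fun x => ?_
    by_cases hx : x ∈ S N
    · simp only [wN, Set.indicator_of_mem hx, Real.norm_eq_abs]
      exact hx.2.trans (le_abs_self _)
    · simp [wN, hx]
  have hB0 : 0 ≤ B := by
    obtain ⟨n, hn⟩ := hB.exists
    refine le_trans ?_ hn
    apply integral_nonneg_of_ae
    filter_upwards [hx_mem] with x hx
    exact mul_nonneg (hwn x hx) ((hF n).nn x)
  have hle : ∀ N, ∫ x, g x * wN N x ∂vP ≤ B := by
    intro N
    refine le_of_tendsto (W _ (hwN N)) ?_
    filter_upwards [hB] with n hn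
    refine le_trans ?_ hn
    apply integral_mono_ae ((hx_memLp (hF n)).integrable_mul (hwN N)) (hi n)
    filter_upwards [hx_mem] with x hx
    rw [mul_comm]
    refine mul_le_mul_of_nonneg_right ?_ ((hF n).nn x)
    by_cases hx' : x ∈ S N
    · simp [wN, hx']
    · simp only [wN, Set.indicator_of_notMem hx']; exact hwn x hx
  have hgm : AEStronglyMeasurable g vP := hg2.1
  have hnn : ∀ N, 0 ≤ᵐ[vP] fun x => g x * wN N x := by
    intro N
    filter_upwards [hx_mem] with x hx
    refine mul_nonneg (hg x) (Set.indicator_apply_nonneg fun _ => hwn x hx)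
  have hfat : ∫⁻ x, ENNReal.ofReal (w x * g x) ∂vP ≤ ENNReal.ofReal B := by
    calc ∫⁻ x, ENNReal.ofReal (w x * g x) ∂vP
        = ∫⁻ x, liminf (fun N => ENNReal.ofReal (g x * wN N x)) atTop ∂vP := by
          apply lintegral_congr
          intro x
          symm
          apply Tendsto.liminf_eq
          apply tendsto_const_nhds.congr'
          obtain ⟨N0, hN0⟩ := exists_nat_ge (max ‖x‖ |w x|)
          filter_upwards [eventually_ge_atTop N0] with N hN
          have hN' : (N0 : ℝ) ≤ N := by exact_mod_cast hN
          have hx : x ∈ S N := by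
            refine ⟨?_, ?_⟩
            · rw [mem_closedBall_zero_iff]
              exact (le_max_left _ _).trans (hN0.trans hN')
            · exact (le_max_right _ _).trans (hN0.trans hN')
          simp only [wN, Set.indicator_of_mem hx]
          rw [mul_comm]
      _ ≤ liminf (fun N => ∫⁻ x, ENNReal.ofReal (g x * wN N x) ∂vP) atTop := by
          apply lintegral_liminf_le'
          intro N
          exact (hgm.aemeasurable.mul (hwN N).1.aemeasurable).ennreal_ofReal
      _ ≤ liminf (fun _ : ℕ => ENNReal.ofReal B) atTop := by
          refine liminf_le_liminf (Filter.Eventually.of_forall fun N => ?_)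
          have hmul : Integrable (fun x => g x * wN N x) vP := hg2.integrable_mul (hwN N)
          rw [← ofReal_integral_eq_lintegral_ofReal hmul (hnn N)]
          exact ENNReal.ofReal_le_ofReal (hle N)
      _ = _ := liminf_const _
  have hnn2 : 0 ≤ᵐ[vP] fun x => w x * g x := by
    filter_upwards [hx_mem] with x hx
    exact mul_nonneg (hwn x hx) (hg x)
  have hInt0 : Integrable (fun x => w x * g x) vP := by
    refine ⟨hw.aestronglyMeasurable.mul hgm, ?_⟩
    rw [hasFiniteIntegral_iff_ofReal hnn2]
    exact lt_of_le_of_lt hfat ENNReal.ofReal_lt_top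
  refine ⟨hInt0, ?_⟩
  rw [← ofReal_integral_eq_lintegral_ofReal hInt0 hnn2] at hfat
  exact (ENNReal.ofReal_le_ofReal_iff hB0).mp hfat

open MeasureTheory Real Filter

/-! ### The relaxed class and the closure lemma -/

structure Cls (μ ν : ℝ) (f : ℝ × ℝ → ℝ) : Prop where
  fn : Fn f
  ii : Integrable (fun x => x.2 * f x) vP
  im : ∫ x, x.2 * f x ∂vP ≤ μ
  ma : ∫ x, f x ∂vP ≤ ν

lemma hx_GU_memLp {x : ℝ × ℝ} (hx : x ∈ UHP) : MemLp (fun y => GUHP x y) 2 vP :=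
  (memLp_two_iff_integrable_sq (hx_GUHP_meas' x).aestronglyMeasurable).mpr (hx_GU_sq_int hx)

lemma hx_fmul_int {f h : ℝ × ℝ → ℝ} (hf : Fn f) (hh : MemLp h 2 vP) :
    Integrable (fun x => f x * h x) vP := (hx_memLp hf).integrable_mul hh

lemma hx_Gop_bd {f : ℝ × ℝ → ℝ} (hf : Fn f) {M : ℝ} (hM : ∫ y, f y ^ 2 ∂vP ≤ M)
    {x : ℝ × ℝ} (hx : x ∈ UHP) : Gop f x ≤ (hxC2 + M) / 2 := by
  have := hx_Gop_le hf hx one_pos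
  linarith

lemma hx_Gind_memLp {f : ℝ × ℝ → ℝ} (hf : Fn f) {D : Set (ℝ × ℝ)} (hD : MeasurableSet D)
    (hDf : vP D ≠ ⊤) : MemLp (D.indicator (Gop f)) 2 vP := by
  have h1 : MemLp (D.indicator fun _ => (hxC2 + ∫ y, f y ^ 2 ∂vP) / 2) 2 vP :=
    memLp_indicator_const 2 hD _ (Or.inr hDf)
  refine h1.mono ((hx_Gop_ms hf).indicator hD) ?_
  filter_upwards [hx_mem] with x hx
  by_cases hx' : x ∈ D
  · simp only [Set.indicator_of_mem hx', Real.norm_eq_abs]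
    rw [abs_of_nonneg (hx_Gop_nonneg hf hx)]
    exact (hx_Gop_bd hf le_rfl hx).trans (le_abs_self _)
  · simp [hx']

lemma hx_D_conv {F : ℕ → ℝ × ℝ → ℝ} (hF : ∀ n, Fn (F n)) {g : ℝ × ℝ → ℝ} (hg : Fn g)
    {M : ℝ} (hM : ∀ n, ∫ x, F n x ^ 2 ∂vP ≤ M)
    (W : ∀ h, MemLp h 2 vP →
        Tendsto (fun n => ∫ x, F n x * h x ∂vP) atTop (nhds (∫ x, g x * h x ∂vP)))
    {D : Set (ℝ × ℝ)} (hD : MeasurableSet D) (hDf : vP D ≠ ⊤) :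
    Tendsto (fun n => ∫ x in D, F n x * Gop (F n) x ∂vP) atTop
      (nhds (∫ x in D, g x * Gop g x ∂vP)) := by
  have hM0 : 0 ≤ M := (integral_nonneg fun _ => sq_nonneg _).trans (hM 0)
  set B := (hxC2 + M) / 2 + (hxC2 + ∫ y, g y ^ 2 ∂vP) / 2 with hBdef
  have ind : ∀ f : ℝ × ℝ → ℝ, ∀ k : ℝ × ℝ → ℝ,
      ∫ x in D, f x * k x ∂vP = ∫ x, f x * D.indicator k x ∂vP := by
    intro f k
    rw [← integral_indicator hD]
    congr 1; ext x
    by_cases hx : x ∈ D <;> simp [hx]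
  let d : ℕ → ℝ × ℝ → ℝ := fun n => D.indicator (Gop (F n)) - D.indicator (Gop g)
  have hdL : ∀ n, MemLp (d n) 2 vP := fun n =>
    (hx_Gind_memLp (hF n) hD hDf).sub (hx_Gind_memLp hg hD hDf)
  have he : Tendsto (fun n => ∫ x, d n x ^ 2 ∂vP) atTop (nhds 0) := by
    have e0 : (0 : ℝ) = ∫ x : ℝ × ℝ, (0 : ℝ) ∂vP := by simp
    rw [e0]
    apply tendsto_integral_of_dominated_convergence (D.indicator fun _ => B ^ 2)
    · intro n; exact (hdL n).1.pow 2
    · exact (integrable_indicator_iff hD).mpr (integrableOn_const hDf)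
    · intro n
      filter_upwards [hx_mem] with x hx
      rw [Real.norm_eq_abs, abs_of_nonneg (sq_nonneg _)]
      by_cases hx' : x ∈ D
      · simp only [d, Pi.sub_apply, Set.indicator_of_mem hx']
        have a1 := hx_Gop_nonneg (hF n) hx
        have a2 := hx_Gop_nonneg hg hx
        have a3 := hx_Gop_bd (hF n) (hM n) hx
        have a4 := hx_Gop_bd hg le_rfl hx
        apply sq_le_sq'
        · linarith
        · linarith
      · simp [d, hx']
    · filter_upwards [hx_mem] with x hx
      by_cases hx' : x ∈ D
      · simp only [d, Pi.sub_apply, Set.indicator_of_mem hx']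
        have h1 := W _ (hx_GU_memLp hx)
        have h2 : Tendsto (fun n => Gop (F n) x) atTop (nhds (Gop g x)) := by
          have eq : ∀ f : ℝ × ℝ → ℝ, ∫ y, f y * GUHP x y ∂vP = Gop f x := by
            intro f; unfold Gop; congr 1; ext y; ring
          simpa only [eq] using h1
        have h3 := (h2.sub_const (Gop g x)).pow 2
        simpa using h3
      · simp [d, hx']
  have hr : Tendsto (fun n => ∫ x, F n x * d n x ∂vP) atTop (nhds 0) := by
    rw [Metric.tendsto_atTop]
    intro δ hδ
    have ht : 0 < δ / (M + 1) := by positivity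
    set t := δ / (M + 1) with htd
    have h2 : ∀ᶠ n in atTop, ∫ x, d n x ^ 2 ∂vP < t * δ := by
      apply he.eventually_lt_const; positivity
    obtain ⟨N, hN⟩ := h2.exists_forall_of_atTop
    refine ⟨N, fun n hn => ?_⟩
    rw [Real.dist_0_eq_abs]
    have i1 := (hF n).i2
    have i2 : Integrable (fun x => d n x ^ 2) vP := (hdL n).integrable_sq
    have h3 : |∫ x, F n x * d n x ∂vP| ≤ ∫ x, (t / 2 * F n x ^ 2 + 1 / (2 * t) * d n x ^ 2) ∂vP := by
      refine (abs_integral_le_integral_abs).trans ?_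
      apply integral_mono (hx_fmul_int (hF n) (hdL n)).abs ((i1.const_mul _).add (i2.const_mul _))
      intro x
      simp only [Pi.add_apply]
      rw [abs_mul]
      have : t / 2 * F n x ^ 2 + 1 / (2 * t) * d n x ^ 2 - |F n x| * |d n x| =
          1 / (2 * t) * (t * |F n x| - |d n x|) ^ 2 := by
        rw [← sq_abs (F n x), ← sq_abs (d n x)]
        field_simp; ring
      have h5 : 0 ≤ 1 / (2 * t) * (t * |F n x| - |d n x|) ^ 2 := by positivity
      linarith
    rw [integral_add (i1.const_mul _) (i2.const_mul _), integral_const_mul, integral_const_mul] at h3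
    have h4 : t / 2 * ∫ x, F n x ^ 2 ∂vP ≤ t / 2 * M :=
      mul_le_mul_of_nonneg_left (hM n) (by positivity)
    have h5 : 1 / (2 * t) * ∫ x, d n x ^ 2 ∂vP < 1 / (2 * t) * (t * δ) :=
      mul_lt_mul_of_pos_left (hN n hn) (by positivity)
    have e5 : 1 / (2 * t) * (t * δ) = δ / 2 := by field_simp
    have h6 : t / 2 * M ≤ δ / 2 := by
      rw [htd]
      have : δ / (M + 1) * M ≤ δ := by
        rw [div_mul_eq_mul_div, div_le_iff₀ (by positivity)]
        nlinarith
      linarith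
    linarith
  have hm := (W _ (hx_Gind_memLp hg hD hDf)).add hr
  rw [add_zero] at hm
  rw [ind]
  refine hm.congr fun n => ?_
  rw [ind, ← integral_add (hx_fmul_int (hF n) (hx_Gind_memLp hg hD hDf)) (hx_fmul_int (hF n) (hdL n))]
  congr 1; ext x
  simp only [d, Pi.sub_apply]; ring

lemma hx_E_split {f : ℝ × ℝ → ℝ} {μ ν : ℝ} (hf : Cls μ ν f) {M : ℝ} (hM : ∫ y, f y ^ 2 ∂vP ≤ M)
    {R1 R2 δ : ℝ} (hR2 : 0 < R2) (hR : (hxC2 + M) / 2 * μ ≤ δ * R2)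
    (ht : ∫ x in {x : ℝ × ℝ | R1 < |x.1|}, f x * Gop f x ∂vP ≤ δ) :
    ∫ x, f x * Gop f x ∂vP ≤
      (∫ x in {x : ℝ × ℝ | |x.1| ≤ R1 ∧ |x.2| ≤ R2}, f x * Gop f x ∂vP) + 2 * δ := by
  have hM0 : 0 ≤ M := (integral_nonneg fun _ => sq_nonneg _).trans hM
  have hC := hx_C2_nonneg
  set B := (hxC2 + M) / 2 with hB
  have hB0 : 0 ≤ B := by positivity
  have mD : MeasurableSet {x : ℝ × ℝ | |x.1| ≤ R1 ∧ |x.2| ≤ R2} :=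
    (measurableSet_le measurable_fst.abs measurable_const).inter
      (measurableSet_le measurable_snd.abs measurable_const)
  have mT : MeasurableSet {x : ℝ × ℝ | R1 < |x.1|} := measurableSet_lt measurable_const measurable_fst.abs
  have hi := hx_fG_int hf.fn
  have h1 : ∫ x, f x * Gop f x ∂vP ≤
     ∫ x, ((({x : ℝ × ℝ | |x.1| ≤ R1 ∧ |x.2| ≤ R2}).indicator (fun x => f x * Gop f x) x +
      ({x : ℝ × ℝ | R1 < |x.1|}).indicator (fun x => f x * Gop f x) x) + B / R2 * (x.2 * f x)) ∂vP := by
    apply integral_mono_ae hi (((hi.indicator mD).add (hi.indicator mT)).add (hf.ii.const_mul _))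
    filter_upwards [hx_mem] with x hx
    simp only [Pi.add_apply]
    have hx2 : 0 < x.2 := hx
    have p := mul_nonneg (hf.fn.nn x) (hx_Gop_nonneg hf.fn hx)
    have q : 0 ≤ B / R2 * (x.2 * f x) := by
      have := hf.fn.nn x
      positivity
    by_cases c1 : R1 < |x.1|
    · have : 0 ≤ ({x : ℝ × ℝ | |x.1| ≤ R1 ∧ |x.2| ≤ R2}).indicator (fun x => f x * Gop f x) x :=
        Set.indicator_apply_nonneg fun _ => p
      have e : ({x : ℝ × ℝ | R1 < |x.1|}).indicator (fun x => f x * Gop f x) x = f x * Gop f x :=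
        Set.indicator_of_mem (show x ∈ {x : ℝ × ℝ | R1 < |x.1|} from c1) _
      rw [e]; linarith
    · have : 0 ≤ ({x : ℝ × ℝ | R1 < |x.1|}).indicator (fun x => f x * Gop f x) x :=
        Set.indicator_apply_nonneg fun _ => p
      by_cases c2 : |x.2| ≤ R2
      · have e : ({x : ℝ × ℝ | |x.1| ≤ R1 ∧ |x.2| ≤ R2}).indicator (fun x => f x * Gop f x) x =
            f x * Gop f x := Set.indicator_of_mem
              (show x ∈ {x : ℝ × ℝ | |x.1| ≤ R1 ∧ |x.2| ≤ R2} from ⟨not_lt.mp c1, c2⟩) _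
        rw [e]; linarith
      · have e : 0 ≤ ({x : ℝ × ℝ | |x.1| ≤ R1 ∧ |x.2| ≤ R2}).indicator (fun x => f x * Gop f x) x :=
          Set.indicator_apply_nonneg fun _ => p
        rw [abs_of_pos hx2, not_le] at c2
        have b := hx_Gop_bd hf.fn hM hx
        have : f x * Gop f x ≤ B / R2 * (x.2 * f x) := by
          calc f x * Gop f x ≤ f x * B := mul_le_mul_of_nonneg_left b (hf.fn.nn x)
            _ ≤ f x * B * (x.2 / R2) := by
                apply le_mul_of_one_le_right (mul_nonneg (hf.fn.nn x) hB0)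
                rw [one_le_div hR2]; exact c2.le
            _ = _ := by field_simp
        linarith
  have i12 : Integrable (fun x => ({x : ℝ × ℝ | |x.1| ≤ R1 ∧ |x.2| ≤ R2}).indicator (fun x => f x * Gop f x) x +
      ({x : ℝ × ℝ | R1 < |x.1|}).indicator (fun x => f x * Gop f x) x) vP :=
    (hi.indicator mD).add (hi.indicator mT)
  rw [integral_add i12 (hf.ii.const_mul _), integral_add (hi.indicator mD) (hi.indicator mT),
    integral_indicator mD, integral_indicator mT, integral_const_mul] at h1
  have h2 : B / R2 * ∫ x, x.2 * f x ∂vP ≤ δ := by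
    calc _ ≤ B / R2 * μ := mul_le_mul_of_nonneg_left hf.im (by positivity)
      _ = B * μ / R2 := by ring
      _ ≤ δ := by rw [div_le_iff₀ hR2]; exact hR
  linarith

lemma hx_closure {lam μ ν : ℝ} (hl : 0 < lam) {f : ℕ → ℝ × ℝ → ℝ} (hf : ∀ n, Cls μ ν (f n))
    {M : ℝ} (hM : ∀ n, ∫ x, f n x ^ 2 ∂vP ≤ M) {w : ℝ × ℝ → ℝ} (hw : Measurable w)
    (hwn : ∀ x ∈ UHP, 0 ≤ w x) (hwi : ∀ n, Integrable (fun x => w x * f n x) vP)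
    (tail : ∀ δ > 0, ∃ R : ℝ, ∀ n, ∫ x in {x : ℝ × ℝ | R < |x.1|}, f n x * Gop (f n) x ∂vP ≤ δ) :
    ∃ φ : ℕ → ℕ, StrictMono φ ∧ ∃ g, Cls μ ν g ∧ ∀ (s : ℕ → ℝ) (s0 : ℝ),
      Tendsto s atTop (nhds s0) → (∀ n, s n ≤ Efun lam (f n) - ∫ x, w x * f n x ∂vP) →
      Integrable (fun x => w x * g x) vP ∧ s0 ≤ Efun lam g - ∫ x, w x * g x ∂vP := by
  obtain ⟨φ, hφ, g, hg0, hg2, W⟩ := hx_weak (fun n => (hf n).fn) hM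
  have F := fun n => (hf (φ n)).fn
  have w1 := hx_weight F hg0 hg2 W (w := fun _ => 1) measurable_const (fun _ _ => zero_le_one)
    (fun n => by simpa using (F n).i1) (B := ν)
    (Eventually.of_forall fun n => by simpa using (hf (φ n)).ma)
  have w2 := hx_weight F hg0 hg2 W (w := fun x => x.2) measurable_snd (fun x hx => le_of_lt hx)
    (fun n => (hf (φ n)).ii) (B := μ) (Eventually.of_forall fun n => (hf (φ n)).im)
  simp only [one_mul] at w1
  have hg : Fn g := ⟨hg0, w1.1, hg2.integrable_sq⟩
  refine ⟨φ, hφ, g, ⟨hg, w2.1, w2.2, w1.2⟩, ?_⟩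
  intro s s0 hs hle
  have key : ∀ δ > 0, Integrable (fun x => w x * g x) vP ∧
      s0 ≤ Efun lam g - (∫ x, w x * g x ∂vP) + 2 * δ := by
    intro δ hδ
    obtain ⟨R1, hR1⟩ := tail δ hδ
    have hM0 : 0 ≤ M := (integral_nonneg fun _ => sq_nonneg _).trans (hM 0)
    obtain ⟨R2, hR2, hR⟩ : ∃ R2 : ℝ, 0 < R2 ∧ (hxC2 + M) / 2 * μ ≤ δ * R2 := by
      refine ⟨max 1 ((hxC2 + M) / 2 * μ / δ), lt_max_of_lt_left one_pos, ?_⟩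
      rw [← div_le_iff₀' hδ]
      exact le_max_right _ _
    set D := {x : ℝ × ℝ | |x.1| ≤ R1 ∧ |x.2| ≤ R2} with hDd
    have mD : MeasurableSet D :=
      (measurableSet_le measurable_fst.abs measurable_const).inter
        (measurableSet_le measurable_snd.abs measurable_const)
    have fD : vP D ≠ ⊤ := by
      refine ne_top_of_le_ne_top (measure_closedBall_lt_top (μ := vP) (x := (0 : ℝ × ℝ)) (r := max R1 R2)).ne
        (measure_mono ?_)
      intro x hx
      rw [mem_closedBall_zero_iff, Prod.norm_def]
      exact max_le_max hx.1 hx.2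
    have hA := hx_D_conv F hg (fun n => hM (φ n)) W mD fD
    have hQ := W g hg2
    have hX := ((hA.const_mul (1 / 2)).sub (hQ.const_mul (1 / lam))).sub (hs.comp hφ.tendsto_atTop)
    set L := 1 / 2 * (∫ x in D, g x * Gop g x ∂vP) - 1 / lam * (∫ x, g x * g x ∂vP) - s0 with hL
    have hev := hX.eventually_lt_const (show L < L + δ by linarith)
    have egg : ∫ x, g x * g x ∂vP = ∫ x, g x ^ 2 ∂vP := by congr 1; ext x; ring
    have hb : ∀ᶠ n in atTop, ∫ x, w x * f (φ n) x ∂vP ≤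
        L + 2 * δ + 1 / (2 * lam) * ∫ x, g x ^ 2 ∂vP := by
      filter_upwards [hev] with n hn
      have h1 := hle (φ n)
      have h2 := hx_E_split (hf (φ n)) (hM (φ n)) hR2 hR (hR1 (φ n))
      have h3 : 2 * (∫ x, f (φ n) x * g x ∂vP) - (∫ x, g x ^ 2 ∂vP) ≤ ∫ x, f (φ n) x ^ 2 ∂vP := by
        have i1 := hx_fmul_int (F n) hg2
        rw [← integral_const_mul, ← integral_sub (i1.const_mul _) hg.i2]
        apply integral_mono ((i1.const_mul _).sub hg.i2) (F n).i2
        intro x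
        simp only [Pi.sub_apply]
        nlinarith [sq_nonneg (f (φ n) x - g x)]
      have h4 : Efun lam (f (φ n)) = 1 / 2 * (∫ x, f (φ n) x * Gop (f (φ n)) x ∂vP) -
          1 / (2 * lam) * ∫ x, f (φ n) x ^ 2 ∂vP := rfl
      have h5 := mul_le_mul_of_nonneg_left h3 (show 0 ≤ 1 / (2 * lam) by positivity)
      have e6 : 1 / (2 * lam) * (2 * (∫ x, f (φ n) x * g x ∂vP) - (∫ x, g x ^ 2 ∂vP)) =
        1 / lam * (∫ x, f (φ n) x * g x ∂vP) - 1 / (2 * lam) * (∫ x, g x ^ 2 ∂vP) := by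
          field_simp
      simp only [Function.comp_apply] at hn
      linarith
    obtain ⟨r1, r2⟩ := hx_weight F hg0 hg2 W hw hwn (fun n => hwi (φ n)) hb
    refine ⟨r1, ?_⟩
    have h4 : Efun lam g = 1 / 2 * (∫ x, g x * Gop g x ∂vP) -
          1 / (2 * lam) * ∫ x, g x ^ 2 ∂vP := rfl
    have h7 : ∫ x in D, g x * Gop g x ∂vP ≤ ∫ x, g x * Gop g x ∂vP := by
      apply setIntegral_le_integral (hx_fG_int hg)
      filter_upwards [hx_mem] with x hx
      exact mul_nonneg (hg0 x) (hx_Gop_nonneg hg hx)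
    have e8 : 1 / lam * (∫ x, g x ^ 2 ∂vP) = 2 * (1 / (2 * lam) * (∫ x, g x ^ 2 ∂vP)) := by
      field_simp
    rw [hL, egg, e8] at r2
    rw [h4]
    linarith
  refine ⟨(key 1 one_pos).1, ?_⟩
  apply le_of_forall_pos_le_add
  intro η hη
  have := (key (η / 2) (by positivity)).2
  linarith

open MeasureTheory Real Filter

/-! ### Polarization -/

def hxR (c : ℝ) (x : ℝ × ℝ) : ℝ × ℝ := (2 * c - x.1, x.2)

lemma hx_R_inv (c : ℝ) : Function.Involutive (hxR c) := by
  intro x; unfold hxR; ext <;> simp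

lemma hx_R_R (c : ℝ) (x : ℝ × ℝ) : hxR c (hxR c x) = x := hx_R_inv c x

lemma hx_R_mp (c : ℝ) : MeasurePreserving (hxR c) vP vP := by
  rw [hx_vP_prod]
  exact (Measure.measurePreserving_sub_left (volume : Measure ℝ) (2 * c)).prod (MeasurePreserving.id _)

lemma hx_R_mem {c : ℝ} {x : ℝ × ℝ} (hx : x ∈ UHP) : hxR c x ∈ UHP := hx

lemma hx_inv_int {α : Type*} [MeasurableSpace α] {m : Measure α} {T : α → α}
    (hT : MeasurePreserving T m m) (hi : Function.Involutive T) (g : α → ℝ) :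
    ∫ x, g (T x) ∂m = ∫ x, g x ∂m :=
  hT.integral_comp (MeasurableEquiv.ofInvolutive T hi hT.measurable).measurableEmbedding g

lemma hx_mp_int {α : Type*} [MeasurableSpace α] {m : Measure α} {T : α → α}
    (hT : MeasurePreserving T m m) {g : α → ℝ} (hg : Integrable g m) :
    Integrable (fun x => g (T x)) m := by
  have := hT.integrable_comp_of_integrable hg
  exact this

lemma hx_GUHP_R (c : ℝ) (x y : ℝ × ℝ) : GUHP (hxR c x) y = GUHP x (hxR c y) := by
  unfold GUHP Gker rad reflPt hxR
  simp only [Prod.fst_sub, Prod.snd_sub]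
  have e : (2 * c - x.1 - y.1) ^ 2 = (x.1 - (2 * c - y.1)) ^ 2 := by ring
  rw [e]

lemma hx_GUHP_form (x y : ℝ × ℝ) : GUHP x y = (1 / (2 * π)) *
    (K0 (√((x.1 - y.1) ^ 2 + (x.2 - y.2) ^ 2)) -
      K0 (√((x.1 - y.1) ^ 2 + (x.2 - y.2) ^ 2 + 4 * x.2 * y.2))) := by
  unfold GUHP Gker rad reflPt
  simp only [Prod.fst_sub, Prod.snd_sub]
  have e : (x.1 - y.1) ^ 2 + (-x.2 - y.2) ^ 2 =
    (x.1 - y.1) ^ 2 + (x.2 - y.2) ^ 2 + 4 * x.2 * y.2 := by ring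
  rw [e]; ring

lemma hx_G_mono {c : ℝ} {x y : ℝ × ℝ} (hx : x ∈ UHP) (hy : y ∈ UHP) (hne : x ≠ y)
    (h : 0 ≤ (x.1 - c) * (y.1 - c)) : GUHP x (hxR c y) ≤ GUHP x y := by
  have hx' : 0 < x.2 := hx
  have hy' : 0 < y.2 := hy
  rw [hx_GUHP_form, hx_GUHP_form]
  apply mul_le_mul_of_nonneg_left _ hx_c_pos.le
  have hp : 0 < (x.1 - y.1) ^ 2 + (x.2 - y.2) ^ 2 := by
    rcases lt_or_eq_of_le (show 0 ≤ (x.1 - y.1) ^ 2 + (x.2 - y.2) ^ 2 by positivity) with h | h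
    · exact h
    · exfalso; apply hne
      have h1 : (x.1 - y.1) ^ 2 = 0 := by nlinarith [sq_nonneg (x.1 - y.1), sq_nonneg (x.2 - y.2)]
      have h2 : (x.2 - y.2) ^ 2 = 0 := by nlinarith [sq_nonneg (x.1 - y.1), sq_nonneg (x.2 - y.2)]
      have h3 := pow_eq_zero_iff (two_ne_zero) |>.mp h1
      have h4 := pow_eq_zero_iff (two_ne_zero) |>.mp h2
      exact Prod.ext (by linarith) (by linarith)
  have := hx_K0_super hp (show 0 ≤ 4 * ((x.1 - c) * (y.1 - c)) by linarith)
    (show 0 ≤ 4 * x.2 * y.2 by positivity)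
  have e1 : (x.1 - (hxR c y).1) ^ 2 + (x.2 - (hxR c y).2) ^ 2 =
      (x.1 - y.1) ^ 2 + (x.2 - y.2) ^ 2 + 4 * ((x.1 - c) * (y.1 - c)) := by
    unfold hxR; simp only; ring
  have e2 : 4 * x.2 * (hxR c y).2 = 4 * x.2 * y.2 := rfl
  rw [e1, e2]
  linarith

open Classical in
noncomputable def hxPol (c : ℝ) (f : ℝ × ℝ → ℝ) : ℝ × ℝ → ℝ :=
  ({x : ℝ × ℝ | x.1 < c}).piecewise (fun x => max (f x) (f (hxR c x))) (fun x => min (f x) (f (hxR c x)))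

lemma hx_pol_lt {c : ℝ} {f : ℝ × ℝ → ℝ} {x : ℝ × ℝ} (h : x.1 < c) :
    hxPol c f x = max (f x) (f (hxR c x)) := by
  unfold hxPol; exact Set.piecewise_eq_of_mem _ _ _ h

lemma hx_pol_ge {c : ℝ} {f : ℝ × ℝ → ℝ} {x : ℝ × ℝ} (h : c ≤ x.1) :
    hxPol c f x = min (f x) (f (hxR c x)) := by
  unfold hxPol; exact Set.piecewise_eq_of_notMem _ _ _ (by simpa using h)

lemma hx_pol_ge' {c : ℝ} {f : ℝ × ℝ → ℝ} {x : ℝ × ℝ} (h : x.1 < c) :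
    hxPol c f (hxR c x) = min (f x) (f (hxR c x)) := by
  rw [hx_pol_ge (by simp only [hxR]; linarith), hx_R_R, min_comm]

lemma hx_pol_le' {c : ℝ} {f : ℝ × ℝ → ℝ} {x : ℝ × ℝ} (h : c ≤ x.1) :
    hxPol c f (hxR c x) = max (f x) (f (hxR c x)) := by
  rcases h.lt_or_eq with h | h
  · rw [hx_pol_lt (by simp only [hxR]; linarith), hx_R_R, max_comm]
  · have e : hxR c x = x := by
      unfold hxR; ext <;> simp; linarith
    rw [e, hx_pol_ge h.le, e]; simp

lemma hx_pol_sum (c : ℝ) (f : ℝ × ℝ → ℝ) (x : ℝ × ℝ) :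
    hxPol c f x + hxPol c f (hxR c x) = f x + f (hxR c x) := by
  rcases lt_or_ge x.1 c with h | h
  · rw [hx_pol_lt h, hx_pol_ge' h, max_add_min]
  · rw [hx_pol_ge h, hx_pol_le' h, min_add_max]

lemma hx_pol_cases (c : ℝ) (f : ℝ × ℝ → ℝ) (x : ℝ × ℝ) :
    (hxPol c f x = f x ∧ hxPol c f (hxR c x) = f (hxR c x)) ∨
    (hxPol c f x = f (hxR c x) ∧ hxPol c f (hxR c x) = f x) := by
  rcases lt_or_ge x.1 c with h | h
  · rw [hx_pol_lt h, hx_pol_ge' h]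
    rcases le_total (f x) (f (hxR c x)) with h' | h'
    · right; simp [h']
    · left; simp [h']
  · rw [hx_pol_ge h, hx_pol_le' h]
    rcases le_total (f x) (f (hxR c x)) with h' | h'
    · left; simp [h']
    · right; simp [h']

lemma hx_pol_nn {c : ℝ} {f : ℝ × ℝ → ℝ} (hf : ∀ x, 0 ≤ f x) (x : ℝ × ℝ) : 0 ≤ hxPol c f x := by
  rcases hx_pol_cases c f x with h | h <;> rw [h.1] <;> exact hf _

lemma hx_pol_ms {c : ℝ} {f : ℝ × ℝ → ℝ} (hf : AEStronglyMeasurable f vP) :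
    AEStronglyMeasurable (hxPol c f) vP := by
  classical
  have hr : AEStronglyMeasurable (fun x => f (hxR c x)) vP :=
    hf.comp_measurePreserving (hx_R_mp c)
  have hS : MeasurableSet {x : ℝ × ℝ | x.1 < c} := measurableSet_lt measurable_fst measurable_const
  unfold hxPol
  have h1 : AEStronglyMeasurable (fun x => max (f x) (f (hxR c x))) vP := hf.sup hr
  have h2 : AEStronglyMeasurable (fun x => min (f x) (f (hxR c x))) vP := hf.inf hr
  convert AEStronglyMeasurable.piecewise hS h1.restrict h2.restrict using 1

/-- weights invariant under the reflection -/
lemma hx_pol_int {c : ℝ} {f : ℝ × ℝ → ℝ} (hf : AEStronglyMeasurable f vP) {Φ : ℝ × ℝ → ℝ → ℝ}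
    (hΦ : ∀ x t, Φ (hxR c x) t = Φ x t)
    (hm : AEStronglyMeasurable (fun x => Φ x (hxPol c f x)) vP)
    (hi : Integrable (fun x => Φ x (f x)) vP) :
    Integrable (fun x => Φ x (hxPol c f x)) vP ∧
    ∫ x, Φ x (hxPol c f x) ∂vP = ∫ x, Φ x (f x) ∂vP := by
  have hir := hx_mp_int (hx_R_mp c) hi
  have i1 : Integrable (fun x => Φ x (hxPol c f x)) vP := by
    refine Integrable.mono' (hi.norm.add hir.norm) hm ?_
    refine Eventually.of_forall fun x => ?_
    simp only [Pi.add_apply, hΦ]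
    rcases hx_pol_cases c f x with h | h <;> rw [h.1]
    · exact le_add_of_nonneg_right (norm_nonneg _)
    · exact le_add_of_nonneg_left (norm_nonneg _)
  have i2 := hx_mp_int (hx_R_mp c) i1
  refine ⟨i1, ?_⟩
  have e1 := hx_inv_int (hx_R_mp c) (hx_R_inv c) (fun x => Φ x (hxPol c f x))
  have e2 := hx_inv_int (hx_R_mp c) (hx_R_inv c) (fun x => Φ x (f x))
  have e3 : (∫ x, Φ x (hxPol c f x) ∂vP) + ∫ x, Φ (hxR c x) (hxPol c f (hxR c x)) ∂vP =
      (∫ x, Φ x (f x) ∂vP) + ∫ x, Φ (hxR c x) (f (hxR c x)) ∂vP := by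
    rw [← integral_add i1 i2, ← integral_add hi hir]
    congr 1; ext x
    simp only [hΦ]
    rcases hx_pol_cases c f x with h | h <;> rw [h.1, h.2]
    ring
  linarith

lemma hx_pol_fn {c : ℝ} {f : ℝ × ℝ → ℝ} (hf : Fn f) :
    Fn (hxPol c f) ∧ ∫ x, hxPol c f x ∂vP = ∫ x, f x ∂vP ∧
      ∫ x, hxPol c f x ^ 2 ∂vP = ∫ x, f x ^ 2 ∂vP := by
  have m := hx_pol_ms (c := c) hf.ms
  have h1 := hx_pol_int (c := c) hf.ms (Φ := fun _ t => t) (fun _ _ => rfl) m hf.i1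
  have h2 := hx_pol_int (c := c) hf.ms (Φ := fun _ t => t ^ 2) (fun _ _ => rfl) (m.pow 2) hf.i2
  exact ⟨⟨hx_pol_nn hf.nn, h1.1, h2.1⟩, h1.2, h2.2⟩

lemma hx_pol_cls {c μ ν : ℝ} {f : ℝ × ℝ → ℝ} (hf : Cls μ ν f) : Cls μ ν (hxPol c f) := by
  obtain ⟨a, b, d⟩ := hx_pol_fn (c := c) hf.fn
  have h1 := hx_pol_int (c := c) hf.fn.ms (Φ := fun x t => x.2 * t) (fun _ _ => rfl)
    (measurable_snd.aestronglyMeasurable.mul a.ms) hf.ii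
  exact ⟨a, h1.1, h1.2.le.trans hf.im, b.le.trans hf.ma⟩

lemma hx_pair_ae (c : ℝ) : ∀ᵐ p ∂(vP.prod vP), p.1 ∈ UHP ∧ p.2 ∈ UHP ∧ p.1 ≠ p.2 ∧ p.1 ≠ hxR c p.2 := by
  have hR : Measurable (hxR c) := (hx_R_mp c).measurable
  rw [Measure.ae_prod_iff_ae_ae]
  · filter_upwards [hx_mem] with x hx
    filter_upwards [hx_mem, hx_ne x, hx_ne (hxR c x)] with y hy h1 h2
    refine ⟨hx, hy, h1.symm, ?_⟩
    rintro h; apply h2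
    rw [h, hx_R_R]
  · have h1 : MeasurableSet {p : (ℝ × ℝ) × (ℝ × ℝ) | p.1 ∈ UHP} := measurable_fst hx_UHP_meas
    have h2 : MeasurableSet {p : (ℝ × ℝ) × (ℝ × ℝ) | p.2 ∈ UHP} := measurable_snd hx_UHP_meas
    have h3 : MeasurableSet {p : (ℝ × ℝ) × (ℝ × ℝ) | p.1 ≠ p.2} :=
      (measurableSet_eq_fun measurable_fst measurable_snd).compl
    have h4 : MeasurableSet {p : (ℝ × ℝ) × (ℝ × ℝ) | p.1 ≠ hxR c p.2} :=
      (measurableSet_eq_fun measurable_fst (hR.comp measurable_snd)).compl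
    exact h1.inter (h2.inter (h3.inter h4))

lemma hx_four {c : ℝ} {u v : (ℝ × ℝ) × (ℝ × ℝ) → ℝ} (hu : Integrable u (vP.prod vP))
    (hv : Integrable v (vP.prod vP))
    (h : ∀ᵐ p ∂(vP.prod vP),
      u p + u (hxR c p.1, p.2) + u (p.1, hxR c p.2) + u (hxR c p.1, hxR c p.2) ≤
      v p + v (hxR c p.1, p.2) + v (p.1, hxR c p.2) + v (hxR c p.1, hxR c p.2)) :
    ∫ p, u p ∂(vP.prod vP) ≤ ∫ p, v p ∂(vP.prod vP) := by
  have m1 : MeasurePreserving (Prod.map (hxR c) id) (vP.prod vP) (vP.prod vP) :=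
    (hx_R_mp c).prod (MeasurePreserving.id _)
  have m2 : MeasurePreserving (Prod.map id (hxR c)) (vP.prod vP) (vP.prod vP) :=
    (MeasurePreserving.id _).prod (hx_R_mp c)
  have m3 : MeasurePreserving (Prod.map (hxR c) (hxR c)) (vP.prod vP) (vP.prod vP) :=
    (hx_R_mp c).prod (hx_R_mp c)
  have v1 : Function.Involutive (Prod.map (hxR c) (id : ℝ × ℝ → ℝ × ℝ)) :=
    fun p => Prod.ext (hx_R_R c _) rfl
  have v2 : Function.Involutive (Prod.map (id : ℝ × ℝ → ℝ × ℝ) (hxR c)) :=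
    fun p => Prod.ext rfl (hx_R_R c _)
  have v3 : Function.Involutive (Prod.map (hxR c) (hxR c)) :=
    fun p => Prod.ext (hx_R_R c _) (hx_R_R c _)
  have key : ∀ {w : (ℝ × ℝ) × (ℝ × ℝ) → ℝ}, Integrable w (vP.prod vP) →
      Integrable (fun p => w p + w (hxR c p.1, p.2) + w (p.1, hxR c p.2) + w (hxR c p.1, hxR c p.2))
        (vP.prod vP) ∧
      ∫ p, (w p + w (hxR c p.1, p.2) + w (p.1, hxR c p.2) + w (hxR c p.1, hxR c p.2)) ∂(vP.prod vP)
        = 4 * ∫ p, w p ∂(vP.prod vP) := by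
    intro w hw
    have j1 : Integrable (fun p : (ℝ × ℝ) × (ℝ × ℝ) => w (hxR c p.1, p.2)) (vP.prod vP) := hx_mp_int m1 hw
    have j2 : Integrable (fun p : (ℝ × ℝ) × (ℝ × ℝ) => w (p.1, hxR c p.2)) (vP.prod vP) := hx_mp_int m2 hw
    have j3 : Integrable (fun p : (ℝ × ℝ) × (ℝ × ℝ) => w (hxR c p.1, hxR c p.2)) (vP.prod vP) :=
      hx_mp_int m3 hw
    have k1 : ∫ p, w (hxR c p.1, p.2) ∂(vP.prod vP) = ∫ p, w p ∂(vP.prod vP) := hx_inv_int m1 v1 w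
    have k2 : ∫ p, w (p.1, hxR c p.2) ∂(vP.prod vP) = ∫ p, w p ∂(vP.prod vP) := hx_inv_int m2 v2 w
    have k3 : ∫ p, w (hxR c p.1, hxR c p.2) ∂(vP.prod vP) = ∫ p, w p ∂(vP.prod vP) :=
      hx_inv_int m3 v3 w
    have l1 : Integrable (fun p => w p + w (hxR c p.1, p.2)) (vP.prod vP) := hw.add j1
    have l2 : Integrable (fun p => w p + w (hxR c p.1, p.2) + w (p.1, hxR c p.2)) (vP.prod vP) :=
      l1.add j2
    refine ⟨l2.add j3, ?_⟩
    rw [integral_add l2 j3, integral_add l1 j2, integral_add hw j1, k1, k2, k3]; ring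
  obtain ⟨a1, a2⟩ := key hu
  obtain ⟨b1, b2⟩ := key hv
  have := integral_mono_ae a1 b1 h
  rw [a2, b2] at this
  linarith

lemma hx_rearr {a a' b b' g g' : ℝ} (h : g' ≤ g) :
    g * (a * b + a' * b') + g' * (a * b' + a' * b) ≤
    g * (max a a' * max b b' + min a a' * min b b') +
    g' * (max a a' * min b b' + min a a' * max b b') := by
  rcases le_total a a' with h1 | h1 <;> rcases le_total b b' with h2 | h2 <;>
    simp only [h1, h2, max_eq_left, max_eq_right, min_eq_left, min_eq_right] <;>
    nlinarith [mul_nonneg (sub_nonneg.mpr h) (mul_nonneg (sub_nonneg.mpr h1) (sub_nonneg.mpr h2))]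

lemma hx_pol_E {c : ℝ} {f : ℝ × ℝ → ℝ} (hf : Fn f) : kineticE f ≤ kineticE (hxPol c f) := by
  have hF := (hx_pol_fn (c := c) hf).1
  rw [hx_E_eq hf, hx_E_eq hF]
  apply mul_le_mul_of_nonneg_left _ (by norm_num)
  apply hx_four (c := c) (hx_P_int hf) (hx_P_int hF)
  filter_upwards [hx_pair_ae c] with p hp
  obtain ⟨hx, hy, h1, h2⟩ := hp
  obtain ⟨x, y⟩ := p
  simp only at hx hy h1 h2
  simp only [hxP, hx_GUHP_R, hx_R_R]
  rcases lt_or_ge x.1 c with cx | cx <;> rcases lt_or_ge y.1 c with cy | cy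
  · rw [hx_pol_lt cx, hx_pol_ge' cx, hx_pol_lt cy, hx_pol_ge' cy]
    have := hx_rearr (a := f x) (a' := f (hxR c x)) (b := f y) (b' := f (hxR c y))
      (hx_G_mono (c := c) hx hy h1 (by nlinarith))
    linarith
  · rw [hx_pol_lt cx, hx_pol_ge' cx, hx_pol_ge cy, hx_pol_le' cy]
    have := hx_G_mono (c := c) hx (hx_R_mem hy) h2 (by simp only [hxR]; nlinarith)
    rw [hx_R_R] at this
    have := hx_rearr (a := f x) (a' := f (hxR c x)) (b := f (hxR c y)) (b' := f y) this
    rw [max_comm (f (hxR c y)), min_comm (f (hxR c y))] at this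
    linarith
  · rw [hx_pol_ge cx, hx_pol_le' cx, hx_pol_lt cy, hx_pol_ge' cy]
    have := hx_G_mono (c := c) hx (hx_R_mem hy) h2 (by simp only [hxR]; nlinarith)
    rw [hx_R_R] at this
    have := hx_rearr (a := f x) (a' := f (hxR c x)) (b := f (hxR c y)) (b' := f y) this
    rw [max_comm (f (hxR c y)), min_comm (f (hxR c y))] at this
    linarith
  · rw [hx_pol_ge cx, hx_pol_le' cx, hx_pol_ge cy, hx_pol_le' cy]
    have := hx_rearr (a := f x) (a' := f (hxR c x)) (b := f y) (b' := f (hxR c y))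
      (hx_G_mono (c := c) hx hy h1 (by nlinarith))
    linarith

lemma hx_pol_Efun {c lam : ℝ} {f : ℝ × ℝ → ℝ} (hf : Fn f) :
    Efun lam f ≤ Efun lam (hxPol c f) := by
  have h := hx_pol_E (c := c) hf
  have e := (hx_pol_fn (c := c) hf).2.2
  unfold Efun
  have e' : ∫ x in UHP, hxPol c f x ^ 2 = ∫ x in UHP, f x ^ 2 := e
  rw [e']; linarith

lemma hx_absR {c t : ℝ} (hc : 0 < c) (h : t < c) : |t| < |2 * c - t| := by
  rw [abs_of_pos (show 0 < 2 * c - t by linarith), abs_lt]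
  constructor <;> linarith

lemma hx_pol_w {c : ℝ} (hc : 0 < c) {f : ℝ × ℝ → ℝ} (hf : Fn f)
    (hi : Integrable (fun x => |x.1| * f x) vP) :
    Integrable (fun x => |x.1| * hxPol c f x) vP ∧
    ((∫ x, |x.1| * f x ∂vP ≤ ∫ x, |x.1| * hxPol c f x ∂vP) →
      ∀ᵐ x ∂vP, x.1 < c → f (hxR c x) ≤ f x) := by
  have hF := (hx_pol_fn (c := c) hf).1
  have mF := hF.ms
  have hr := hx_mp_int (hx_R_mp c) hi
  have hfr := hx_mp_int (hx_R_mp c) hf.i1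
  have i1 : Integrable (fun x => |x.1| * hxPol c f x) vP := by
    refine Integrable.mono' (((hi.add hr).add (hfr.const_mul (2 * c))))
      (measurable_fst.abs.aestronglyMeasurable.mul mF) ?_
    refine Eventually.of_forall fun x => ?_
    rw [Real.norm_eq_abs, abs_of_nonneg (mul_nonneg (abs_nonneg _) (hF.nn x))]
    simp only [Pi.add_apply]
    have a1 := hf.nn x
    have a2 := hf.nn (hxR c x)
    have a3 : |x.1| ≤ |(hxR c x).1| + 2 * c := by
      have : x.1 = 2 * c - (hxR c x).1 := by simp [hxR]
      calc |x.1| = |2 * c - (hxR c x).1| := by rw [← this]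
        _ ≤ |2 * c| + |(hxR c x).1| := abs_sub _ _
        _ = _ := by rw [abs_of_pos (by linarith : 0 < 2 * c)]; ring
    rcases hx_pol_cases c f x with h | h <;> rw [h.1]
    · have : 0 ≤ |(hxR c x).1| * f (hxR c x) := by positivity
      have : 0 ≤ 2 * c * f (hxR c x) := by positivity
      linarith
    · have : 0 ≤ |x.1| * f x := by positivity
      nlinarith
  refine ⟨i1, fun hle => ?_⟩
  have i2 := hx_mp_int (hx_R_mp c) i1
  have e1 := hx_inv_int (hx_R_mp c) (hx_R_inv c) (fun x => |x.1| * hxPol c f x)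
  have e2 := hx_inv_int (hx_R_mp c) (hx_R_inv c) (fun x => |x.1| * f x)
  have k : ∀ x : ℝ × ℝ, |x.1| * f x + |(hxR c x).1| * f (hxR c x) -
      (|x.1| * hxPol c f x + |(hxR c x).1| * hxPol c f (hxR c x)) =
      (|(hxR c x).1| - |x.1|) * (hxPol c f x - f x) := by
    intro x
    have := hx_pol_sum c f x
    have e : hxPol c f (hxR c x) = f x + f (hxR c x) - hxPol c f x := by linarith
    rw [e]; ring
  have nn : ∀ x : ℝ × ℝ, 0 ≤ (|(hxR c x).1| - |x.1|) * (hxPol c f x - f x) := by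
    intro x
    rcases lt_or_ge x.1 c with h | h
    · rw [hx_pol_lt h]
      apply mul_nonneg
      · have := hx_absR hc h; simp only [hxR]; linarith
      · have := le_max_left (f x) (f (hxR c x)); linarith
    · rw [hx_pol_ge h]
      apply mul_nonneg_of_nonpos_of_nonpos
      · rcases h.lt_or_eq with h | h
        · have := hx_absR hc (t := 2 * c - x.1) (by linarith)
          have e : 2 * c - (2 * c - x.1) = x.1 := by ring
          rw [e] at this
          simp only [hxR]; linarith
        · have e : (hxR c x).1 = x.1 := by simp only [hxR]; linarith
          rw [e]; simp
      · have := min_le_left (f x) (f (hxR c x)); linarith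
  have ik : Integrable (fun x => (|(hxR c x).1| - |x.1|) * (hxPol c f x - f x)) vP :=
    ((hi.add hr).sub (i1.add i2)).congr (Eventually.of_forall k)
  have hz : ∫ x, (|(hxR c x).1| - |x.1|) * (hxPol c f x - f x) ∂vP = 0 := by
    apply le_antisymm _ (integral_nonneg nn)
    have : ∫ x, (|(hxR c x).1| - |x.1|) * (hxPol c f x - f x) ∂vP =
      ∫ x, ((|x.1| * f x + |(hxR c x).1| * f (hxR c x)) -
      (|x.1| * hxPol c f x + |(hxR c x).1| * hxPol c f (hxR c x))) ∂vP :=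
      integral_congr_ae (Eventually.of_forall fun x => (k x).symm)
    have l1 : Integrable (fun x => |x.1| * f x + |(hxR c x).1| * f (hxR c x)) vP := hi.add hr
    have l2 : Integrable (fun x => |x.1| * hxPol c f x + |(hxR c x).1| * hxPol c f (hxR c x)) vP :=
      i1.add i2
    rw [this, integral_sub l1 l2, integral_add hi hr, integral_add i1 i2, e1, e2]
    linarith
  have hz' := (integral_eq_zero_iff_of_nonneg nn ik).mp hz
  filter_upwards [hz'] with x hx h
  simp only [Pi.zero_apply] at hx
  rcases mul_eq_zero.mp hx with h1 | h1
  · have := hx_absR hc h; simp only [hxR] at h1; linarith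
  · rw [hx_pol_lt h] at h1
    have := le_max_right (f x) (f (hxR c x)); linarith

/-- one-sided monotonicity -/
def hxMono (f : ℝ × ℝ → ℝ) : Prop := ∀ c > 0, ∀ᵐ x ∂vP, x.1 < c → f (hxR c x) ≤ f x

def hxMax (lam μ ν ε : ℝ) (f : ℝ × ℝ → ℝ) : Prop :=
  Cls μ ν f ∧ Integrable (fun x => |x.1| * f x) vP ∧
  ∀ g, Cls μ ν g → Integrable (fun x => |x.1| * g x) vP →
    Efun lam g - ε * ∫ x, |x.1| * g x ∂vP ≤ Efun lam f - ε * ∫ x, |x.1| * f x ∂vP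

lemma hx_max_mono {lam μ ν ε : ℝ} (hε : 0 < ε) {f : ℝ × ℝ → ℝ} (h : hxMax lam μ ν ε f) : hxMono f := by
  intro c hc
  obtain ⟨hf, hi, hm⟩ := h
  obtain ⟨h1, h2⟩ := hx_pol_w hc hf.fn hi
  apply h2
  have h3 := hm _ (hx_pol_cls (c := c) hf) h1
  have h4 := hx_pol_Efun (c := c) (lam := lam) hf.fn
  have : ε * ∫ x, |x.1| * f x ∂vP ≤ ε * ∫ x, |x.1| * hxPol c f x ∂vP := by linarith
  exact le_of_mul_le_mul_left this hε

lemma hx_Gop_R (c : ℝ) (f : ℝ × ℝ → ℝ) (x : ℝ × ℝ) :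
    Gop (fun y => f (hxR c y)) x = Gop f (hxR c x) := by
  unfold Gop
  have := hx_inv_int (hx_R_mp c) (hx_R_inv c) (fun y => GUHP x (hxR c y) * f y)
  simp only [hx_R_R] at this
  refine this.trans ?_
  apply integral_congr_ae
  refine Eventually.of_forall fun y => ?_
  simp only [hx_GUHP_R]

lemma hx_max_refl {lam μ ν ε : ℝ} {f : ℝ × ℝ → ℝ} (h : hxMax lam μ ν ε f) :
    hxMax lam μ ν ε (fun x => f (hxR 0 x)) := by
  obtain ⟨hf, hi, hm⟩ := h
  have mp := hx_R_mp 0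
  have iv := hx_R_inv 0
  have ew : ∀ x : ℝ × ℝ, |(hxR 0 x).1| = |x.1| := by intro x; simp [hxR]
  have hi' := hx_mp_int mp hi
  simp only [ew] at hi'
  refine ⟨⟨⟨fun x => hf.fn.nn _, hx_mp_int mp hf.fn.i1, hx_mp_int mp hf.fn.i2⟩,
    hx_mp_int mp hf.ii, (hx_inv_int mp iv (fun x => x.2 * f x)).le.trans hf.im,
    (hx_inv_int mp iv f).le.trans hf.ma⟩, hi', ?_⟩
  intro g hg hgi
  have e1 := hx_inv_int mp iv (fun x => |x.1| * f x)
  simp only [ew] at e1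
  rw [e1]
  have e2 : Efun lam (fun x => f (hxR 0 x)) = Efun lam f := by
    unfold Efun kineticE
    have a := hx_inv_int mp iv (fun x => f x ^ 2)
    have b := hx_inv_int mp iv (fun x => f x * Gop f x)
    simp only [hx_Gop_R]
    rw [a, b]
  rw [e2]
  exact hm g hg hgi

open MeasureTheory Real Filter

/-! ### Penalised existence -/

lemma hx_zero_cls {μ ν : ℝ} (hμ : 0 < μ) (hν : 0 < ν) : Cls μ ν (fun _ => 0) := by
  refine ⟨⟨fun _ => le_rfl, by simp, by simp⟩, by simp, by simpa using hμ.le, by simpa using hν.le⟩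

lemma hx_zero_Efun (lam : ℝ) : Efun lam (fun _ => 0) = 0 := by
  simp [Efun, kineticE]

lemma hx_tail_w {μ ν M K R : ℝ} {f : ℝ × ℝ → ℝ} (hf : Cls μ ν f) (hM : ∫ y, f y ^ 2 ∂vP ≤ M)
    (hi : Integrable (fun x => |x.1| * f x) vP) (hK : ∫ x, |x.1| * f x ∂vP ≤ K) (hR : 0 < R) :
    ∫ x in {x : ℝ × ℝ | R < |x.1|}, f x * Gop f x ∂vP ≤ (hxC2 + M) / 2 * K / R := by
  have hM0 : 0 ≤ M := (integral_nonneg fun _ => sq_nonneg _).trans hM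
  have hC := hx_C2_nonneg
  set B := (hxC2 + M) / 2 with hB
  have hB0 : 0 ≤ B := by positivity
  have mT : MeasurableSet {x : ℝ × ℝ | R < |x.1|} := measurableSet_lt measurable_const measurable_fst.abs
  rw [← integral_indicator mT]
  calc _ ≤ ∫ x, B / R * (|x.1| * f x) ∂vP := by
        apply integral_mono_ae ((hx_fG_int hf.fn).indicator mT) (hi.const_mul _)
        filter_upwards [hx_mem] with x hx
        have a1 := hf.fn.nn x
        by_cases c : x ∈ {x : ℝ × ℝ | R < |x.1|}
        · rw [Set.indicator_of_mem c]
          have c' : R < |x.1| := c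
          calc f x * Gop f x ≤ f x * B := mul_le_mul_of_nonneg_left (hx_Gop_bd hf.fn hM hx) a1
            _ ≤ f x * B * (|x.1| / R) := by
                apply le_mul_of_one_le_right (mul_nonneg a1 hB0)
                rw [one_le_div hR]; exact c'.le
            _ = _ := by field_simp
        · rw [Set.indicator_of_notMem c]; positivity
    _ = B / R * ∫ x, |x.1| * f x ∂vP := integral_const_mul _ _
    _ ≤ B / R * K := mul_le_mul_of_nonneg_left hK (by positivity)
    _ = _ := by ring

lemma hx_max_exists {lam μ ν ε : ℝ} (hl : 0 < lam) (hμ : 0 < μ) (hν : 0 < ν) (hε : 0 < ε) :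
    ∃ f, hxMax lam μ ν ε f := by
  set C := ν ^ 2 * lam * hxC2 / 4 with hC
  let S : Set ℝ := {s | ∃ g, Cls μ ν g ∧ Integrable (fun x => |x.1| * g x) vP ∧
    s = Efun lam g - ε * ∫ x, |x.1| * g x ∂vP}
  have hup : ∀ g, Cls μ ν g →
      Efun lam g - ε * (∫ x, |x.1| * g x ∂vP) ≤ C - (1 / (4 * lam)) * (∫ x, g x ^ 2 ∂vP)
        - ε * ∫ x, |x.1| * g x ∂vP := by
    intro g hg
    have := hx_Efun_le hg.fn hl hν hg.ma
    linarith
  have nn2 : ∀ g : ℝ × ℝ → ℝ, 0 ≤ ∫ x, g x ^ 2 ∂vP := fun g => integral_nonneg fun _ => sq_nonneg _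
  have nnw : ∀ g, Cls μ ν g → 0 ≤ ∫ x, |x.1| * g x ∂vP := fun g hg =>
    integral_nonneg fun x => mul_nonneg (abs_nonneg _) (hg.fn.nn x)
  have hbdd : BddAbove S := by
    refine ⟨C, ?_⟩
    rintro s ⟨g, hg, hi, rfl⟩
    have h1 := hup g hg
    have h2 : 0 ≤ 1 / (4 * lam) * ∫ x, g x ^ 2 ∂vP := mul_nonneg (by positivity) (nn2 g)
    have h3 := mul_nonneg hε.le (nnw g hg)
    linarith
  have hne : S.Nonempty := ⟨_, _, hx_zero_cls hμ hν, by simp, rfl⟩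
  obtain ⟨u, hmono, hlim, hu⟩ := exists_seq_tendsto_sSup hne hbdd
  choose f hf hi hfu using hu
  have hb : ∀ n, (∫ x, f n x ^ 2 ∂vP ≤ 4 * lam * (C - u 0)) ∧ ∫ x, |x.1| * f n x ∂vP ≤ (C - u 0) / ε := by
    intro n
    have h1 := hup _ (hf n)
    rw [← hfu n] at h1
    have h0 := hmono (Nat.zero_le n)
    have h2 : 0 ≤ 1 / (4 * lam) * ∫ x, f n x ^ 2 ∂vP := mul_nonneg (by positivity) (nn2 _)
    have h3 := mul_nonneg hε.le (nnw _ (hf n))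
    constructor
    · have : 1 / (4 * lam) * (∫ x, f n x ^ 2 ∂vP) ≤ C - u 0 := by linarith
      rw [one_div, inv_mul_le_iff₀ (by positivity)] at this
      exact this
    · rw [le_div_iff₀ hε]
      linarith
  have hw : ∀ (g : ℝ × ℝ → ℝ), ∫ x, ε * |x.1| * g x ∂vP = ε * ∫ x, |x.1| * g x ∂vP := by
    intro g
    rw [← integral_const_mul]; congr 1; ext x; ring
  obtain ⟨φ, -, g, hg, hcl⟩ := hx_closure (lam := lam) hl hf (fun n => (hb n).1)
    (w := fun x => ε * |x.1|) (measurable_fst.abs.const_mul ε) (fun x _ => by positivity)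
    (fun n => by
      have := (hi n).const_mul ε
      refine this.congr (Eventually.of_forall fun x => ?_)
      simp only; ring)
    (by
      intro δ hδ
      set Q := (hxC2 + 4 * lam * (C - u 0)) / 2 * ((C - u 0) / ε)
      refine ⟨max 1 (Q / δ), fun n => ?_⟩
      have hR : 0 < max 1 (Q / δ) := lt_max_of_lt_left one_pos
      refine (hx_tail_w (hf n) (hb n).1 (hi n) (hb n).2 hR).trans ?_
      rw [div_le_iff₀ hR, ← div_le_iff₀' hδ]
      exact le_max_right _ _)
  obtain ⟨r1, r2⟩ := hcl u _ hlim (fun n => by rw [hw]; exact (hfu n).le)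
  rw [hw] at r2
  refine ⟨g, hg, ?_, ?_⟩
  · have := r1.const_mul (1 / ε)
    refine this.congr (Eventually.of_forall fun x => ?_)
    simp only; field_simp
  · intro k hk hki
    refine le_trans ?_ r2
    exact le_csSup hbdd ⟨k, hk, hki, rfl⟩

open MeasureTheory Real Filter

/-! ### Uniform tails for monotone functions -/

noncomputable def hxk (s : ℝ) : ℝ := (1 / (2 * π)) * K0 |s|

noncomputable def hxC1 : ℝ := ∫ s, hxk s

lemma hx_k_meas : Measurable hxk := (hx_K0_meas.comp measurable_abs).const_mul _

lemma hx_k_nonneg (s : ℝ) : 0 ≤ hxk s := mul_nonneg hx_c_pos.le (hx_K0_nonneg _)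

lemma hx_C1_nonneg : 0 ≤ hxC1 := integral_nonneg hx_k_nonneg

lemma hx_k_lint : ∫⁻ s, ENNReal.ofReal (hxk s) = ENNReal.ofReal hxC1 := by
  unfold hxC1
  have hi : Integrable hxk := hx_line_int.const_mul _
  rw [ofReal_integral_eq_lintegral_ofReal hi (Eventually.of_forall hx_k_nonneg)]

lemma hx_mass_lint {f : ℝ × ℝ → ℝ} (hf : Fn f) {ν : ℝ} (h : ∫ x, f x ∂vP ≤ ν) :
    ∫⁻ y, ENNReal.ofReal (f y) ∂vP ≤ ENNReal.ofReal ν := by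
  rw [← ofReal_integral_eq_lintegral_ofReal hf.i1 (Eventually.of_forall hf.nn)]
  exact ENNReal.ofReal_le_ofReal h

lemma hx_part {f : ℝ × ℝ → ℝ} (hf : Fn f) {ν : ℝ} (hν : ∫ x, f x ∂vP ≤ ν) (hm : hxMono f) (a : ℝ)
    {A : ℝ} (hA : 0 < A) :
    ∫⁻ y, ({y : ℝ × ℝ | A < y.1}).indicator
      (fun y => ENNReal.ofReal (hxk (a - y.1)) * ENNReal.ofReal (f y)) y ∂vP
      ≤ ENNReal.ofReal (hxC1 * ν / (2 * A)) := by
  set P := ∫⁻ y, ({y : ℝ × ℝ | A < y.1}).indicator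
      (fun y => ENNReal.ofReal (hxk (a - y.1)) * ENNReal.ofReal (f y)) y ∂vP with hP
  have h1 : ∀ t ∈ Set.Ioo (0 : ℝ) (2 * A),
      P ≤ ∫⁻ y, ENNReal.ofReal (hxk (a - t + y.1)) * ENNReal.ofReal (f y) ∂vP := by
    intro t ht
    have mp := hx_R_mp (t / 2)
    have e : ∫⁻ y, ENNReal.ofReal (hxk (a - t + (hxR (t / 2) y).1)) * ENNReal.ofReal (f (hxR (t / 2) y)) ∂vP
        = ∫⁻ y, ENNReal.ofReal (hxk (a - t + y.1)) * ENNReal.ofReal (f y) ∂vP :=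
      mp.lintegral_comp_emb
        (MeasurableEquiv.ofInvolutive _ (hx_R_inv (t / 2)) mp.measurable).measurableEmbedding
        (fun y => ENNReal.ofReal (hxk (a - t + y.1)) * ENNReal.ofReal (f y))
    rw [← e]
    apply lintegral_mono_ae
    have := mp.quasiMeasurePreserving.ae (hm (t / 2) (by linarith [ht.1]))
    filter_upwards [this] with y hy
    rw [hx_R_R] at hy
    by_cases c : y ∈ {y : ℝ × ℝ | A < y.1}
    · rw [Set.indicator_of_mem c]
      have c' : A < y.1 := c
      have e2 : a - t + (hxR (t / 2) y).1 = a - y.1 := by simp only [hxR]; ring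
      rw [e2]
      gcongr
      apply hy
      simp only [hxR]
      linarith [ht.2]
    · rw [Set.indicator_of_notMem c]; exact zero_le
  have h2 : ENNReal.ofReal (2 * A) * P ≤ ENNReal.ofReal hxC1 * ENNReal.ofReal ν := by
    calc ENNReal.ofReal (2 * A) * P = ∫⁻ t in Set.Ioo (0 : ℝ) (2 * A), P := by
          rw [setLIntegral_const, Real.volume_Ioo, sub_zero, mul_comm]
      _ ≤ ∫⁻ t in Set.Ioo (0 : ℝ) (2 * A),
            ∫⁻ y, ENNReal.ofReal (hxk (a - t + y.1)) * ENNReal.ofReal (f y) ∂vP :=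
          setLIntegral_mono' measurableSet_Ioo h1
      _ = ∫⁻ y, (∫⁻ t in Set.Ioo (0 : ℝ) (2 * A),
            ENNReal.ofReal (hxk (a - t + y.1)) * ENNReal.ofReal (f y)) ∂vP := by
          apply lintegral_lintegral_swap
          have q1 : AEMeasurable (fun p : ℝ × (ℝ × ℝ) => ENNReal.ofReal (hxk (a - p.1 + p.2.1)))
              ((volume.restrict (Set.Ioo 0 (2 * A))).prod vP) :=
            ((hx_k_meas.comp (by fun_prop)).ennreal_ofReal).aemeasurable
          have q2 : AEMeasurable (fun p : ℝ × (ℝ × ℝ) => ENNReal.ofReal (f p.2))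
              ((volume.restrict (Set.Ioo 0 (2 * A))).prod vP) :=
            (hf.ms.aemeasurable.ennreal_ofReal).comp_snd
          exact q1.mul q2
      _ ≤ ∫⁻ y, ENNReal.ofReal hxC1 * ENNReal.ofReal (f y) ∂vP := by
          apply lintegral_mono
          intro y
          simp only
          rw [lintegral_mul_const]
          · gcongr
            calc ∫⁻ t in Set.Ioo (0 : ℝ) (2 * A), ENNReal.ofReal (hxk (a - t + y.1))
                ≤ ∫⁻ t, ENNReal.ofReal (hxk (a - t + y.1)) := setLIntegral_le_lintegral _ _
              _ = ∫⁻ t, ENNReal.ofReal (hxk ((a + y.1) - t)) := by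
                  congr 1; ext t; congr 2; ring
              _ = ∫⁻ s, ENNReal.ofReal (hxk s) :=
                  lintegral_sub_left_eq_self (fun s => ENNReal.ofReal (hxk s)) (a + y.1)
              _ = _ := hx_k_lint
          · exact (hx_k_meas.comp (by fun_prop)).ennreal_ofReal
      _ = ENNReal.ofReal hxC1 * ∫⁻ y, ENNReal.ofReal (f y) ∂vP := by
          rw [lintegral_const_mul' _ _ ENNReal.ofReal_ne_top]
      _ ≤ _ := by gcongr; exact hx_mass_lint hf hν
  rw [ENNReal.ofReal_div_of_pos (by positivity), ENNReal.ofReal_mul hx_C1_nonneg,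
    ENNReal.le_div_iff_mul_le (Or.inl (by simpa using hA)) (Or.inl ENNReal.ofReal_ne_top), mul_comm P]
  exact h2

lemma hx_fst_ne (a : ℝ) : ∀ᵐ y ∂vP, y.1 ≠ a := by
  rw [hx_vP_prod]
  have : ∀ᵐ s : ℝ, s ≠ a := by simp [ae_iff]
  exact Measure.quasiMeasurePreserving_fst.ae this

noncomputable def hxEta (ν A : ℝ) : ℝ := (1 / (2 * π)) * K0 A * ν + 2 * (hxC1 * ν / (2 * A))

lemma hx_Gop_far {f : ℝ × ℝ → ℝ} (hf : Fn f) {ν : ℝ} (hν0 : 0 < ν) (hν : ∫ x, f x ∂vP ≤ ν) (hm : hxMono f)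
    (hm' : hxMono (fun x => f (hxR 0 x))) {A : ℝ} (hA : 0 < A) {x : ℝ × ℝ} (hx : x ∈ UHP)
    (hxA : 2 * A < |x.1|) : Gop f x ≤ hxEta ν A := by
  have mp := hx_R_mp 0
  have hf' : Fn (fun x => f (hxR 0 x)) :=
    ⟨fun x => hf.nn _, hx_mp_int mp hf.i1, hx_mp_int mp hf.i2⟩
  have hν' : ∫ x, f (hxR 0 x) ∂vP ≤ ν := (hx_inv_int mp (hx_R_inv 0) f).le.trans hν
  have p1 := hx_part hf hν hm x.1 hA
  have p2 := hx_part hf' hν' hm' (-x.1) hA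
  have e2 := mp.lintegral_comp_emb
        (MeasurableEquiv.ofInvolutive _ (hx_R_inv 0) mp.measurable).measurableEmbedding
        (fun y => ({y : ℝ × ℝ | y.1 < -A}).indicator
      (fun y => ENNReal.ofReal (hxk (x.1 - y.1)) * ENNReal.ofReal (f y)) y)
  have e3 : ∫⁻ y, ({y : ℝ × ℝ | y.1 < -A}).indicator
      (fun y => ENNReal.ofReal (hxk (x.1 - y.1)) * ENNReal.ofReal (f y)) y ∂vP ≤
      ENNReal.ofReal (hxC1 * ν / (2 * A)) := by
    rw [← e2]
    refine le_trans (le_of_eq ?_) p2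
    congr 1; ext y
    have ek : hxk (x.1 - (hxR 0 y).1) = hxk (-x.1 - y.1) := by
      unfold hxk hxR
      simp only
      rw [← abs_neg]
      congr 3; ring
    by_cases c : A < y.1
    · have c1 : hxR 0 y ∈ {y : ℝ × ℝ | y.1 < -A} := by
        simp only [hxR, Set.mem_ofPred_eq]; linarith
      have c2 : y ∈ {y : ℝ × ℝ | A < y.1} := c
      rw [Set.indicator_of_mem c1, Set.indicator_of_mem c2, ek]
    · have c1 : hxR 0 y ∉ {y : ℝ × ℝ | y.1 < -A} := by
        simp only [hxR, Set.mem_ofPred_eq]; linarith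
      have c2 : y ∉ {y : ℝ × ℝ | A < y.1} := c
      rw [Set.indicator_of_notMem c1, Set.indicator_of_notMem c2]
  have hη1 : 0 ≤ (1 / (2 * π)) * K0 A * ν := mul_nonneg (mul_nonneg hx_c_pos.le (hx_K0_nonneg _)) hν0.le
  have hη2 : 0 ≤ hxC1 * ν / (2 * A) := by
    have := hx_C1_nonneg
    positivity
  have hη : 0 ≤ hxEta ν A := by unfold hxEta; linarith
  have hG0 : 0 ≤ᵐ[vP] fun y => GUHP x y * f y := by
    filter_upwards [hx_ae_GUHP hx] with y hy
    exact mul_nonneg hy.1 (hf.nn y)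
  rw [← ENNReal.ofReal_le_ofReal_iff hη]
  unfold Gop
  rw [ofReal_integral_eq_lintegral_ofReal (hx_Gf_int hf hx) hG0]
  have m1 : MeasurableSet {y : ℝ × ℝ | A < y.1} := measurableSet_lt measurable_const measurable_fst
  have m2 : MeasurableSet {y : ℝ × ℝ | y.1 < -A} := measurableSet_lt measurable_fst measurable_const
  have mk : AEMeasurable (fun y : ℝ × ℝ => ENNReal.ofReal (hxk (x.1 - y.1)) * ENNReal.ofReal (f y)) vP :=
    ((hx_k_meas.comp (by fun_prop)).ennreal_ofReal.aemeasurable).mul hf.ms.aemeasurable.ennreal_ofReal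
  calc ∫⁻ y, ENNReal.ofReal (GUHP x y * f y) ∂vP
      ≤ ∫⁻ y, ((({y : ℝ × ℝ | A < y.1}).indicator
          (fun y => ENNReal.ofReal (hxk (x.1 - y.1)) * ENNReal.ofReal (f y)) y +
          ({y : ℝ × ℝ | y.1 < -A}).indicator
          (fun y => ENNReal.ofReal (hxk (x.1 - y.1)) * ENNReal.ofReal (f y)) y) +
          ENNReal.ofReal ((1 / (2 * π)) * K0 A) * ENNReal.ofReal (f y)) ∂vP := by
        apply lintegral_mono_ae
        filter_upwards [hx_ae_GUHP hx, hx_fst_ne x.1] with y hy hne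
        have ab : 0 < |x.1 - y.1| := abs_pos.mpr (sub_ne_zero.mpr hne.symm)
        have rd : |x.1 - y.1| ≤ rad (x - y) := hx_abs_fst_le (x - y)
        have g1 : GUHP x y ≤ hxk (x.1 - y.1) := by
          refine hy.2.trans ?_
          unfold Gker hxk
          exact mul_le_mul_of_nonneg_left (hx_K0_anti ab rd) hx_c_pos.le
        rw [ENNReal.ofReal_mul hy.1]
        by_cases c1 : y ∈ {y : ℝ × ℝ | A < y.1}
        · rw [Set.indicator_of_mem c1, add_assoc]
          refine le_trans ?_ le_self_add
          gcongr
        · by_cases c2 : y ∈ {y : ℝ × ℝ | y.1 < -A}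
          · rw [Set.indicator_of_notMem c1, zero_add, Set.indicator_of_mem c2]
            refine le_trans ?_ le_self_add
            gcongr
          · rw [Set.indicator_of_notMem c1, Set.indicator_of_notMem c2, zero_add, zero_add]
            gcongr
            refine g1.trans ?_
            unfold hxk
            apply mul_le_mul_of_nonneg_left (hx_K0_anti hA ?_) hx_c_pos.le
            have c1' : y.1 ≤ A := not_lt.mp c1
            have c2' : -A ≤ y.1 := not_lt.mp c2
            have : |y.1| ≤ A := abs_le.mpr ⟨c2', c1'⟩
            have := abs_sub_abs_le_abs_sub x.1 y.1
            linarith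
    _ = _ + ∫⁻ y, ENNReal.ofReal ((1 / (2 * π)) * K0 A) * ENNReal.ofReal (f y) ∂vP :=
        lintegral_add_left' ((mk.indicator m1).add (mk.indicator m2)) _
    _ = (_ + _) + ENNReal.ofReal ((1 / (2 * π)) * K0 A) * ∫⁻ y, ENNReal.ofReal (f y) ∂vP := by
        simp only [Pi.add_apply]
        rw [lintegral_add_left' (mk.indicator m1), lintegral_const_mul' _ _ ENNReal.ofReal_ne_top]
    _ ≤ (ENNReal.ofReal (hxC1 * ν / (2 * A)) + ENNReal.ofReal (hxC1 * ν / (2 * A))) +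
          ENNReal.ofReal ((1 / (2 * π)) * K0 A) * ENNReal.ofReal ν := by
        gcongr
        exact hx_mass_lint hf hν
    _ = ENNReal.ofReal (hxEta ν A) := by
        rw [← ENNReal.ofReal_mul (mul_nonneg hx_c_pos.le (hx_K0_nonneg _)), ← ENNReal.ofReal_add hη2 hη2,
          ← ENNReal.ofReal_add (by linarith) hη1]
        congr 1; unfold hxEta; ring

lemma hx_Eta_lim (ν : ℝ) : Tendsto (hxEta ν) atTop (nhds 0) := by
  have h1 := (hx_K0_tendsto.const_mul (1 / (2 * π))).mul_const ν
  have h2 : Tendsto (fun A : ℝ => hxC1 * ν / (2 * A)) atTop (nhds 0) :=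
    Tendsto.div_atTop tendsto_const_nhds (tendsto_id.const_mul_atTop (by norm_num))
  have h3 := h1.add (h2.const_mul 2)
  rw [mul_zero, zero_mul, mul_zero, add_zero] at h3
  exact h3

lemma hx_tail_mono {ν : ℝ} (hν0 : 0 < ν) {δ : ℝ} (hδ : 0 < δ) : ∃ R : ℝ, ∀ f, Fn f → ∫ x, f x ∂vP ≤ ν →
    hxMono f → hxMono (fun x => f (hxR 0 x)) →
    ∫ x in {x : ℝ × ℝ | R < |x.1|}, f x * Gop f x ∂vP ≤ δ := by
  have h := (hx_Eta_lim ν).eventually_lt_const (show 0 < δ / ν by positivity)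
  obtain ⟨A, hA, hA0⟩ := (h.and (eventually_gt_atTop 0)).exists
  refine ⟨2 * A, fun f hf hm h1 h2 => ?_⟩
  have mT : MeasurableSet {x : ℝ × ℝ | 2 * A < |x.1|} :=
    measurableSet_lt measurable_const measurable_fst.abs
  rw [← integral_indicator mT]
  calc _ ≤ ∫ x, f x * (δ / ν) ∂vP := by
        apply integral_mono_ae ((hx_fG_int hf).indicator mT) (hf.i1.mul_const _)
        filter_upwards [hx_mem] with x hx
        have a1 := hf.nn x
        by_cases c : x ∈ {x : ℝ × ℝ | 2 * A < |x.1|}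
        · rw [Set.indicator_of_mem c]
          exact mul_le_mul_of_nonneg_left ((hx_Gop_far hf hν0 hm h1 h2 hA0 hx c).trans hA.le) a1
        · rw [Set.indicator_of_notMem c]; positivity
    _ = (∫ x, f x ∂vP) * (δ / ν) := integral_mul_const _ _
    _ ≤ ν * (δ / ν) := mul_le_mul_of_nonneg_right hm (by positivity)
    _ = δ := by field_simp

open MeasureTheory Real Filter

/-! ### Removing the penalisation -/

lemma hx_cut_fn {f : ℝ × ℝ → ℝ} (hf : Fn f) {S : Set (ℝ × ℝ)} (hS : MeasurableSet S) :
    Fn (S.indicator f) := by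
  refine ⟨fun x => Set.indicator_nonneg (fun x _ => hf.nn x) x, hf.i1.indicator hS, ?_⟩
  refine (hf.i2.indicator hS).congr (Eventually.of_forall fun x => ?_)
  by_cases h : x ∈ S <;> simp [h]

lemma hx_cut_cls {μ ν : ℝ} {f : ℝ × ℝ → ℝ} (hf : Cls μ ν f) {S : Set (ℝ × ℝ)} (hS : MeasurableSet S) :
    Cls μ ν (S.indicator f) := by
  have hF := hx_cut_fn hf.fn hS
  have e : ∀ x : ℝ × ℝ, S.indicator (fun x => x.2 * f x) x = x.2 * S.indicator f x := by
    intro x; by_cases h : x ∈ S <;> simp [h]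
  have i : Integrable (fun x => x.2 * S.indicator f x) vP :=
    (hf.ii.indicator hS).congr (Eventually.of_forall e)
  refine ⟨hF, i, le_trans ?_ hf.im, le_trans ?_ hf.ma⟩
  · apply integral_mono_ae i hf.ii
    filter_upwards [hx_mem] with x hx
    have hx' : 0 < x.2 := hx
    exact mul_le_mul_of_nonneg_left (Set.indicator_le_self' (fun x _ => hf.fn.nn x) x) hx'.le
  · apply integral_mono hF.i1 hf.fn.i1
    exact Set.indicator_le_self' (fun x _ => hf.fn.nn x)

lemma hx_cut_lim {lam : ℝ} {f : ℝ × ℝ → ℝ} (hf : Fn f) :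
    Tendsto (fun N : ℕ => Efun lam (({x : ℝ × ℝ | |x.1| ≤ N}).indicator f)) atTop
      (nhds (Efun lam f)) := by
  have mS : ∀ N : ℕ, MeasurableSet {x : ℝ × ℝ | |x.1| ≤ N} := fun N =>
    measurableSet_le measurable_fst.abs measurable_const
  have hF : ∀ N : ℕ, Fn (({x : ℝ × ℝ | |x.1| ≤ N}).indicator f) := fun N => hx_cut_fn hf (mS N)
  have hle : ∀ (N : ℕ) (x : ℝ × ℝ), ({x : ℝ × ℝ | |x.1| ≤ N}).indicator f x ≤ f x := fun N x =>
    Set.indicator_le_self' (fun x _ => hf.nn x) x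
  have hev : ∀ x : ℝ × ℝ, ∀ᶠ N : ℕ in atTop, ({x : ℝ × ℝ | |x.1| ≤ N}).indicator f x = f x := by
    intro x
    obtain ⟨N0, hN0⟩ := exists_nat_ge |x.1|
    filter_upwards [eventually_ge_atTop N0] with N hN
    apply Set.indicator_of_mem
    have : (N0 : ℝ) ≤ N := by exact_mod_cast hN
    exact hN0.trans this
  have t1 : Tendsto (fun N : ℕ => ∫ x, ({x : ℝ × ℝ | |x.1| ≤ N}).indicator f x ^ 2 ∂vP) atTop
      (nhds (∫ x, f x ^ 2 ∂vP)) := by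
    apply tendsto_integral_of_dominated_convergence (fun x => f x ^ 2)
    · intro N; exact (hF N).i2.1
    · exact hf.i2
    · intro N
      refine Eventually.of_forall fun x => ?_
      rw [Real.norm_eq_abs, abs_of_nonneg (sq_nonneg _)]
      exact pow_le_pow_left₀ ((hF N).nn x) (hle N x) 2
    · refine Eventually.of_forall fun x => ?_
      apply tendsto_const_nhds.congr'
      filter_upwards [hev x] with N hN
      rw [hN]
  have t2 : Tendsto (fun N : ℕ => ∫ p, hxP (({x : ℝ × ℝ | |x.1| ≤ N}).indicator f) p ∂(vP.prod vP)) atTop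
      (nhds (∫ p, hxP f p ∂(vP.prod vP))) := by
    apply tendsto_integral_of_dominated_convergence (fun p => hxP f p)
    · intro N; exact (hx_P_int (hF N)).1
    · exact hx_P_int hf
    · intro N
      filter_upwards [hx_pair_ae 0] with p hp
      have g0 := hx_GUHP_nonneg hp.1 hp.2.1 hp.2.2.1.symm
      have a := (hF N).nn p.1
      have b := (hF N).nn p.2
      unfold hxP
      rw [Real.norm_eq_abs, abs_of_nonneg (by positivity)]
      have := hle N p.1
      have := hle N p.2
      have := hf.nn p.1
      gcongr
    · refine Eventually.of_forall fun p => ?_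
      apply tendsto_const_nhds.congr'
      filter_upwards [hev p.1, hev p.2] with N h1 h2
      unfold hxP
      rw [h1, h2]
  have t3 := (t2.const_mul (1 / 2)).sub (t1.const_mul (1 / (2 * lam)))
  have e : ∀ g, Fn g → Efun lam g = 1 / 2 * (∫ p, hxP g p ∂(vP.prod vP)) -
      1 / (2 * lam) * ∫ x, g x ^ 2 ∂vP := by
    intro g hg
    unfold Efun
    rw [hx_E_eq hg]
  rw [e f hf]
  refine t3.congr fun N => ?_
  rw [e _ (hF N)]

lemma hx_relaxed {lam μ ν : ℝ} (hl : 0 < lam) (hμ : 0 < μ) (hν : 0 < ν) :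
    ∃ f, Cls μ ν f ∧ ∀ g, Cls μ ν g → Efun lam g ≤ Efun lam f := by
  have hε : ∀ n : ℕ, (0 : ℝ) < 1 / ((n : ℝ) + 1) := fun n => by positivity
  choose f hf using fun n : ℕ => hx_max_exists (lam := lam) hl hμ hν (hε n)
  have hb : ∀ n, ∫ x, f n x ^ 2 ∂vP ≤ 4 * lam * (ν ^ 2 * lam * hxC2 / 4) := by
    intro n
    obtain ⟨h1, h2, h3⟩ := hf n
    have h4 := h3 _ (hx_zero_cls hμ hν) (by simp)
    rw [hx_zero_Efun] at h4
    simp only [mul_zero, integral_zero, sub_zero] at h4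
    have h5 := hx_Efun_le h1.fn hl hν h1.ma
    have h6 : 0 ≤ 1 / ((n : ℝ) + 1) * ∫ x, |x.1| * f n x ∂vP :=
      mul_nonneg (hε n).le (integral_nonneg fun x => mul_nonneg (abs_nonneg _) (h1.fn.nn x))
    have : 1 / (4 * lam) * (∫ x, f n x ^ 2 ∂vP) ≤ ν ^ 2 * lam * hxC2 / 4 := by linarith
    rw [one_div, inv_mul_le_iff₀ (by positivity)] at this
    exact this
  obtain ⟨φ, -, g, hg, hcl⟩ := hx_closure (lam := lam) hl (fun n => (hf n).1) hb
    (w := fun _ => 0) measurable_const (fun _ _ => le_rfl) (fun n => by simp)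
    (by
      intro δ hδ
      obtain ⟨R, hR⟩ := hx_tail_mono hν hδ
      exact ⟨R, fun n => hR _ (hf n).1.fn (hf n).1.ma (hx_max_mono (hε n) (hf n))
        (hx_max_mono (hε n) (hx_max_refl (hf n)))⟩)
  simp only [zero_mul, integral_zero, sub_zero] at hcl
  refine ⟨g, hg, ?_⟩
  have step : ∀ k, Cls μ ν k → Integrable (fun x => |x.1| * k x) vP → Efun lam k ≤ Efun lam g := by
    intro k hk hki
    refine (hcl (fun n => Efun lam k - 1 / ((n : ℝ) + 1) * ∫ x, |x.1| * k x ∂vP) _ ?_ ?_).2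
    · have h := (tendsto_one_div_add_atTop_nhds_zero_nat (𝕜 := ℝ)).mul_const (∫ x, |x.1| * k x ∂vP)
      have h' := h.const_sub (Efun lam k)
      simpa using h'
    · intro n
      refine ((hf n).2.2 k hk hki).trans ?_
      have h6 : 0 ≤ 1 / ((n : ℝ) + 1) * ∫ x, |x.1| * f n x ∂vP :=
        mul_nonneg (hε n).le
          (integral_nonneg fun x => mul_nonneg (abs_nonneg _) ((hf n).1.fn.nn x))
      linarith
  intro k hk
  refine le_of_tendsto' (hx_cut_lim (lam := lam) hk.fn) fun N => ?_
  have mS : MeasurableSet {x : ℝ × ℝ | |x.1| ≤ N} :=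
    measurableSet_le measurable_fst.abs measurable_const
  have hc := hx_cut_cls hk mS
  apply step _ hc
  refine Integrable.mono' (hc.fn.i1.const_mul (N : ℝ))
    (measurable_fst.abs.aestronglyMeasurable.mul hc.fn.ms) (Eventually.of_forall fun x => ?_)
  rw [Real.norm_eq_abs, abs_of_nonneg (mul_nonneg (abs_nonneg _) (hc.fn.nn x))]
  by_cases h : x ∈ {x : ℝ × ℝ | |x.1| ≤ N}
  · exact mul_le_mul_of_nonneg_right h (hc.fn.nn x)
  · rw [Set.indicator_of_notMem h]; simp

open MeasureTheory Real Filter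

/-! ### Positivity of the maximum -/

noncomputable def hxm (ρ : ℝ) : ℝ := ∫ z in {z : ℝ × ℝ | rad z < ρ}, (1 / (2 * π)) * K0 (rad z)

lemma hx_ball_meas (ρ : ℝ) : MeasurableSet {z : ℝ × ℝ | rad z < ρ} :=
  measurableSet_lt hx_rad_meas measurable_const

lemma hx_m_lim : Tendsto (fun n : ℕ => hxm n) atTop (nhds 1) := by
  have h : Tendsto (fun n : ℕ => ∫ z in {z : ℝ × ℝ | rad z < n}, (1 / (2 * π)) * K0 (rad z)) atTop
      (nhds (∫ z in ⋃ n : ℕ, {z : ℝ × ℝ | rad z < n}, (1 / (2 * π)) * K0 (rad z))) := by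
    refine tendsto_setIntegral_of_monotone (s := fun n : ℕ => {z : ℝ × ℝ | rad z < (n : ℝ)})
      (fun n => hx_ball_meas _) ?_ ?_
    · intro m n hmn z hz
      have : (m : ℝ) ≤ n := by exact_mod_cast hmn
      exact lt_of_lt_of_le hz this
    · exact (hx_total_int.const_mul _).integrableOn
  have e : (⋃ n : ℕ, {z : ℝ × ℝ | rad z < n}) = Set.univ := by
    ext z
    simp only [Set.mem_iUnion, Set.mem_univ, iff_true]
    exact exists_nat_gt (rad z)
  rw [e, setIntegral_univ, integral_const_mul, hx_total] at h
  have e2 : 1 / (2 * π) * (2 * π) = 1 := by field_simp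
  rw [e2] at h
  exact h

lemma hx_m_shift (x : ℝ × ℝ) (ρ : ℝ) : ∫ y in {y : ℝ × ℝ | rad (x - y) < ρ}, Gker x y = hxm ρ := by
  have m : MeasurableSet {y : ℝ × ℝ | rad (x - y) < ρ} :=
    measurableSet_lt (hx_rad_meas.comp (by fun_prop)) measurable_const
  unfold hxm
  have h := integral_sub_left_eq_self
    (({z : ℝ × ℝ | rad z < ρ}).indicator fun z => (1 / (2 * π)) * K0 (rad z)) volume x
  rw [← integral_indicator m, ← integral_indicator (hx_ball_meas ρ), ← h]
  rfl

lemma hx_G_total (x : ℝ × ℝ) : ∫ y, Gker x y = 1 := by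
  have h := integral_sub_left_eq_self (fun z : ℝ × ℝ => (1 / (2 * π)) * K0 (rad z)) volume x
  have h2 : ∫ z : ℝ × ℝ, (1 / (2 * π)) * K0 (rad z) = 1 := by
    rw [integral_const_mul, hx_total]; field_simp
  exact h.trans h2

def hxB (L : ℝ) : Set (ℝ × ℝ) := Set.Icc (-L) L ×ˢ Set.Ioc 0 (2 * L)
def hxB' (L ρ : ℝ) : Set (ℝ × ℝ) := Set.Icc (-(L - ρ)) (L - ρ) ×ˢ Set.Icc ρ (2 * L - ρ)

lemma hx_B_meas (L : ℝ) : MeasurableSet (hxB L) := measurableSet_Icc.prod measurableSet_Ioc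
lemma hx_B'_meas (L ρ : ℝ) : MeasurableSet (hxB' L ρ) := measurableSet_Icc.prod measurableSet_Icc

lemma hx_B_sub (L : ℝ) : hxB L ⊆ UHP := fun _ hx => hx.2.1
lemma hx_B'_sub {L ρ : ℝ} (hρ : 0 < ρ) : hxB' L ρ ⊆ UHP := fun _ hx => lt_of_lt_of_le hρ hx.2.1
lemma hx_B'_B {L ρ : ℝ} (hρ : 0 < ρ) : hxB' L ρ ⊆ hxB L := by
  intro x hx
  obtain ⟨⟨a, b⟩, c, d⟩ := hx
  exact ⟨⟨by linarith, by linarith⟩, by linarith, by linarith⟩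

lemma hx_B_vol {L : ℝ} (hL : 0 < L) : vP (hxB L) = ENNReal.ofReal (4 * L ^ 2) := by
  rw [Measure.restrict_apply (hx_B_meas L), Set.inter_eq_left.mpr (hx_B_sub L), hxB,
    Measure.volume_eq_prod, Measure.prod_prod, Real.volume_Icc, Real.volume_Ioc,
    ← ENNReal.ofReal_mul (by linarith)]
  congr 1; ring

lemma hx_B'_vol {L ρ : ℝ} (hρ : 0 < ρ) (hL : ρ < L) :
    vP (hxB' L ρ) = ENNReal.ofReal (4 * (L - ρ) ^ 2) := by
  rw [Measure.restrict_apply (hx_B'_meas L ρ), Set.inter_eq_left.mpr (hx_B'_sub hρ), hxB',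
    Measure.volume_eq_prod, Measure.prod_prod, Real.volume_Icc, Real.volume_Icc,
    ← ENNReal.ofReal_mul (by linarith)]
  congr 1; ring

noncomputable def hxh (L : ℝ) : ℝ × ℝ → ℝ := (hxB L).indicator fun _ => 1

lemma hx_h_int {L : ℝ} (hL : 0 < L) : Integrable (hxh L) vP ∧ ∫ x, hxh L x ∂vP = 4 * L ^ 2 := by
  constructor
  · refine (integrable_indicator_iff (hx_B_meas L)).mpr (integrableOn_const ?_)
    rw [hx_B_vol hL]; exact ENNReal.ofReal_ne_top
  · unfold hxh
    rw [integral_indicator_const _ (hx_B_meas L), measureReal_def, hx_B_vol hL,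
      ENNReal.toReal_ofReal (by positivity)]
    simp

lemma hx_h_sq (L : ℝ) (x : ℝ × ℝ) : hxh L x ^ 2 = hxh L x := by
  unfold hxh; by_cases h : x ∈ hxB L <;> simp [h]

lemma hx_h_nn (L : ℝ) (x : ℝ × ℝ) : 0 ≤ hxh L x := Set.indicator_nonneg (fun _ _ => zero_le_one) x

lemma hx_h_fn {L : ℝ} (hL : 0 < L) : Fn (hxh L) := by
  refine ⟨hx_h_nn L, (hx_h_int hL).1, ?_⟩
  simp only [hx_h_sq]; exact (hx_h_int hL).1

lemma hx_h_Gop {L ρ : ℝ} {x : ℝ × ℝ} (hρ : 0 < ρ) (hx : x ∈ hxB' L ρ) :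
    2 * hxm ρ - 1 ≤ Gop (hxh L) x := by
  have e1 : Gop (hxh L) x = (∫ y in hxB L, Gker x y) - ∫ y in hxB L, Gker (reflPt x) y := by
    rw [← integral_sub (hx_G_int x).integrableOn (hx_G_int _).integrableOn]
    have e : Gop (hxh L) x = ∫ y in hxB L, GUHP x y ∂vP := by
      unfold Gop hxh
      rw [← integral_indicator (hx_B_meas L)]
      congr 1; ext y
      by_cases h : y ∈ hxB L <;> simp [h]
    rw [e, Measure.restrict_restrict (hx_B_meas L), Set.inter_eq_left.mpr (hx_B_sub L)]
    rfl
  obtain ⟨⟨a, b⟩, c, d⟩ := hx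
  have h1 : hxm ρ ≤ ∫ y in hxB L, Gker x y := by
    rw [← hx_m_shift x]
    apply setIntegral_mono_set (hx_G_int x).integrableOn
      (Eventually.of_forall fun y => hx_Gker_nonneg x y)
    apply HasSubset.Subset.eventuallyLE
    intro y hy
    have hy : rad (x - y) < ρ := hy
    have h1 := abs_lt.mp ((hx_abs_fst_le (x - y)).trans_lt hy)
    have h2 := abs_lt.mp ((hx_abs_snd_le (x - y)).trans_lt hy)
    simp only [Prod.fst_sub, Prod.snd_sub] at h1 h2
    exact ⟨⟨by linarith, by linarith⟩, by linarith, by linarith⟩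
  have h2 : ∫ y in hxB L, Gker (reflPt x) y ≤ 1 - hxm ρ := by
    have m : MeasurableSet {y : ℝ × ℝ | rad (reflPt x - y) < ρ} :=
      measurableSet_lt (hx_rad_meas.comp (by fun_prop)) measurable_const
    have := integral_add_compl m (hx_G_int (reflPt x))
    rw [hx_m_shift, hx_G_total] at this
    have h3 : ∫ y in hxB L, Gker (reflPt x) y ≤
        ∫ y in {y : ℝ × ℝ | rad (reflPt x - y) < ρ}ᶜ, Gker (reflPt x) y := by
      apply setIntegral_mono_set (hx_G_int _).integrableOn
        (Eventually.of_forall fun y => hx_Gker_nonneg _ y)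
      apply HasSubset.Subset.eventuallyLE
      intro y hy
      show ¬ (rad (reflPt x - y) < ρ)
      rw [not_lt]
      have h2 := hx_abs_snd_le (reflPt x - y)
      simp only [Prod.snd_sub, reflPt] at h2
      have hy2 := hy.2.1
      have := neg_abs_le (-x.2 - y.2)
      unfold reflPt
      linarith
    linarith
  linarith

lemma hx_h_Efun {lam L ρ : ℝ} (hρ : 0 < ρ) (hL : ρ < L) :
    1 / 2 * ((2 * hxm ρ - 1) * (4 * (L - ρ) ^ 2)) - 1 / (2 * lam) * (4 * L ^ 2) ≤ Efun lam (hxh L) := by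
  have hL0 : 0 < L := hρ.trans hL
  have hf := hx_h_fn hL0
  have e : Efun lam (hxh L) = 1 / 2 * (∫ x, hxh L x * Gop (hxh L) x ∂vP) -
    1 / (2 * lam) * ∫ x, hxh L x ^ 2 ∂vP := rfl
  have h1 : (2 * hxm ρ - 1) * (4 * (L - ρ) ^ 2) ≤ ∫ x, hxh L x * Gop (hxh L) x ∂vP := by
    have h2 : ∫ x, (hxB' L ρ).indicator (fun _ => 2 * hxm ρ - 1) x ∂vP =
        (2 * hxm ρ - 1) * (4 * (L - ρ) ^ 2) := by
      rw [integral_indicator_const _ (hx_B'_meas L ρ), measureReal_def, hx_B'_vol hρ hL,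
        ENNReal.toReal_ofReal (by positivity), smul_eq_mul, mul_comm]
    rw [← h2]
    apply integral_mono_ae _ (hx_fG_int hf)
    · filter_upwards [hx_mem] with x hx
      by_cases h : x ∈ hxB' L ρ
      · have h' := hx_B'_B hρ h
        have e3 : hxh L x = 1 := Set.indicator_of_mem h' _
        rw [Set.indicator_of_mem h, e3, one_mul]
        exact hx_h_Gop hρ h
      · rw [Set.indicator_of_notMem h]
        exact mul_nonneg (hf.nn x) (hx_Gop_nonneg hf hx)
    · refine (integrable_indicator_iff (hx_B'_meas L ρ)).mpr (integrableOn_const ?_)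
      rw [hx_B'_vol hρ hL]; exact ENNReal.ofReal_ne_top
  simp only [hx_h_sq, (hx_h_int hL0).2] at e
  rw [e]; linarith

lemma hx_pos_L {lam : ℝ} (hl : 1 < lam) : ∃ L > 0, 0 < Efun lam (hxh L) := by
  have hl0 : 0 < lam := by linarith
  have hlt : 1 / lam < 1 := by rw [div_lt_one hl0]; exact hl
  have t1 : Tendsto (fun n : ℕ => 2 * hxm n - 1) atTop (nhds 1) := by
    have := (hx_m_lim.const_mul 2).sub_const 1
    norm_num at this
    exact this
  obtain ⟨n, hn1, hn2⟩ := ((t1.eventually_const_lt hlt).and (eventually_gt_atTop 0)).exists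
  have hρ : (0 : ℝ) < n := by exact_mod_cast hn2
  set q := 2 * hxm n - 1 with hq
  have t2 : Tendsto (fun k : ℕ => q * (1 - 1 / ((k : ℝ) + 1)) ^ 2) atTop (nhds q) := by
    have h := ((tendsto_one_div_add_atTop_nhds_zero_nat (𝕜 := ℝ)).const_sub 1)
    have := (h.pow 2).const_mul q
    simpa using this
  obtain ⟨k, hk1, hk2⟩ := ((t2.eventually_const_lt hn1).and (eventually_gt_atTop 0)).exists
  have hk : (0 : ℝ) < k := by exact_mod_cast hk2
  set L : ℝ := n * ((k : ℝ) + 1) with hL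
  have hL0 : 0 < L := by positivity
  refine ⟨L, hL0, lt_of_lt_of_le ?_ (hx_h_Efun (lam := lam) hρ (show (n : ℝ) < L by nlinarith))⟩
  have e : 1 - 1 / ((k : ℝ) + 1) = (L - n) / L := by
    rw [hL]; field_simp
  rw [e] at hk1
  have h3 := mul_lt_mul_of_pos_right hk1 (show 0 < L ^ 2 by positivity)
  have e2 : q * ((L - n) / L) ^ 2 * L ^ 2 = q * (L - n) ^ 2 := by field_simp
  rw [e2] at h3
  have e3 : 1 / (2 * lam) * (4 * L ^ 2) = 2 * (1 / lam * L ^ 2) := by field_simp; ring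
  rw [e3]
  linarith

lemma hx_smul_Efun (lam t : ℝ) (f : ℝ × ℝ → ℝ) : Efun lam (fun x => t * f x) = t ^ 2 * Efun lam f := by
  have e : ∀ x, Gop (fun x => t * f x) x = t * Gop f x := by
    intro x
    unfold Gop
    rw [← integral_const_mul]; congr 1; ext y; ring
  unfold Efun kineticE
  have e1 : ∫ x in UHP, t * f x * Gop (fun x => t * f x) x = t ^ 2 * ∫ x in UHP, f x * Gop f x := by
    rw [← integral_const_mul]; congr 1; ext y; rw [e]; ring
  have e2 : ∫ x in UHP, (t * f x) ^ 2 = t ^ 2 * ∫ x in UHP, f x ^ 2 := by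
    rw [← integral_const_mul]; congr 1; ext y; ring
  rw [e1, e2]; ring

lemma hx_pos {lam μ ν : ℝ} (hl : 1 < lam) (hμ : 0 < μ) (hν : 0 < ν) :
    ∃ g, Cls μ ν g ∧ 0 < Efun lam g := by
  obtain ⟨L, hL, hE⟩ := hx_pos_L hl
  set t := min (ν / (4 * L ^ 2)) (μ / (2 * L * (4 * L ^ 2))) with ht
  have ht0 : 0 < t := lt_min (by positivity) (by positivity)
  have hf := hx_h_fn hL
  obtain ⟨i1, i2⟩ := hx_h_int hL
  refine ⟨fun x => t * hxh L x, ?_, ?_⟩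
  · have hle : ∀ᵐ x ∂vP, x.2 * (t * hxh L x) ≤ 2 * L * t * hxh L x ∧ 0 ≤ x.2 * (t * hxh L x) := by
      filter_upwards [hx_mem] with x hx
      have hx' : 0 < x.2 := hx
      have := hf.nn x
      refine ⟨?_, by positivity⟩
      by_cases h : x ∈ hxB L
      · have h2 : x.2 ≤ 2 * L := h.2.2
        have : 0 ≤ t * hxh L x := by positivity
        nlinarith
      · have : hxh L x = 0 := Set.indicator_of_notMem h _
        rw [this]; simp
    have ii : Integrable (fun x => x.2 * (t * hxh L x)) vP := by
      refine Integrable.mono' (i1.const_mul (2 * L * t))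
        (measurable_snd.aestronglyMeasurable.mul (i1.const_mul t).1) ?_
      filter_upwards [hle] with x hx
      rw [Real.norm_eq_abs, abs_of_nonneg hx.2]
      exact hx.1
    refine ⟨⟨fun x => mul_nonneg ht0.le (hf.nn x), i1.const_mul t, ?_⟩, ii, ?_, ?_⟩
    · simp only [mul_pow]; exact hf.i2.const_mul _
    · calc _ ≤ ∫ x, 2 * L * t * hxh L x ∂vP := by
            apply integral_mono_ae ii (i1.const_mul _)
            filter_upwards [hle] with x hx
            exact hx.1
        _ = 2 * L * t * (4 * L ^ 2) := by rw [integral_const_mul, i2]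
        _ = t * (2 * L * (4 * L ^ 2)) := by ring
        _ ≤ μ := by
            rw [← le_div_iff₀ (by positivity)]
            exact min_le_right _ _
    · rw [integral_const_mul, i2, ← le_div_iff₀ (by positivity)]
      exact min_le_left _ _
  · rw [hx_smul_Efun]; positivity

open MeasureTheory Real Filter

/-! ### Lifting and conclusion -/

def hxT (h : ℝ) (x : ℝ × ℝ) : ℝ × ℝ := x + (0, h)

lemma hx_T_ind {h : ℝ} {ψ : ℝ × ℝ → ℝ} (hh : 0 ≤ h) (hψ : ∀ x : ℝ × ℝ, x.2 ≤ h → ψ x = 0) :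
    (fun x => UHP.indicator ψ (x + (0, h))) = UHP.indicator (fun x => ψ (hxT h x)) := by
  funext x
  by_cases hx : x ∈ UHP
  · have hx' : 0 < x.2 := hx
    have h2 : x + (0, h) ∈ UHP := by
      change 0 < x.2 + h
      linarith
    rw [Set.indicator_of_mem h2, Set.indicator_of_mem hx]
    rfl
  · have hx' : x.2 ≤ 0 := not_lt.mp hx
    rw [Set.indicator_of_notMem hx]
    have : ψ (x + (0, h)) = 0 := hψ _ (by change x.2 + h ≤ h; linarith)
    by_cases h2 : x + (0, h) ∈ UHP
    · rw [Set.indicator_of_mem h2, this]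
    · rw [Set.indicator_of_notMem h2]

lemma hx_T_int {h : ℝ} {ψ : ℝ × ℝ → ℝ} (hh : 0 ≤ h) (hψ : ∀ x : ℝ × ℝ, x.2 ≤ h → ψ x = 0) :
    ∫ x, ψ x ∂vP = ∫ x, ψ (hxT h x) ∂vP := by
  have e := integral_add_right_eq_self (μ := (volume : Measure (ℝ × ℝ))) (UHP.indicator ψ) ((0 : ℝ), h)
  rw [hx_T_ind hh hψ, integral_indicator hx_UHP_meas, integral_indicator hx_UHP_meas] at e
  exact e.symm

lemma hx_T_intg {h : ℝ} {ψ : ℝ × ℝ → ℝ} (hh : 0 ≤ h) (hψ : ∀ x : ℝ × ℝ, x.2 ≤ h → ψ x = 0) :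
    Integrable ψ vP ↔ Integrable (fun x => ψ (hxT h x)) vP := by
  have a : Integrable ψ vP ↔ Integrable (UHP.indicator ψ) :=
    (integrable_indicator_iff hx_UHP_meas).symm
  have b : Integrable (fun x => ψ (hxT h x)) vP ↔ Integrable (UHP.indicator fun x => ψ (hxT h x)) :=
    (integrable_indicator_iff hx_UHP_meas).symm
  rw [a, b, ← hx_T_ind hh hψ]
  constructor
  · intro H
    exact H.comp_add_right _
  · intro H
    have := H.comp_sub_right ((0 : ℝ), h)
    simpa using this

lemma hx_T_mem {h : ℝ} (hh : 0 ≤ h) {x : ℝ × ℝ} (hx : x ∈ UHP) : hxT h x ∈ UHP := by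
  have hx' : 0 < x.2 := hx
  change 0 < x.2 + h
  linarith

lemma hx_T_GUHP {h : ℝ} (hh : 0 ≤ h) {x y : ℝ × ℝ} (hx : x ∈ UHP) (hy : y ∈ UHP) :
    GUHP x y ≤ GUHP (hxT h x) (hxT h y) := by
  have hx' : 0 < x.2 := hx
  have hy' : 0 < y.2 := hy
  have a1 : (hxT h x).1 = x.1 := by simp [hxT]
  have a2 : (hxT h x).2 = x.2 + h := by simp [hxT]
  have b1 : (hxT h y).1 = y.1 := by simp [hxT]
  have b2 : (hxT h y).2 = y.2 + h := by simp [hxT]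
  rw [hx_GUHP_form, hx_GUHP_form, a1, a2, b1, b2, show x.2 + h - (y.2 + h) = x.2 - y.2 by ring]
  apply mul_le_mul_of_nonneg_left _ hx_c_pos.le
  have hxy : 0 < x.2 * y.2 := mul_pos hx' hy'
  have h1 : 0 ≤ h * x.2 := mul_nonneg hh hx'.le
  have h2 : 0 ≤ h * y.2 := mul_nonneg hh hy'.le
  have := hx_K0_anti (r := √((x.1-y.1)^2+(x.2-y.2)^2+4*x.2*y.2))
    (s := √((x.1-y.1)^2+(x.2-y.2)^2+4*(x.2+h)*(y.2+h)))
    (Real.sqrt_pos.mpr (by nlinarith [sq_nonneg (x.1-y.1), sq_nonneg (x.2-y.2)]))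
    (Real.sqrt_le_sqrt (by nlinarith [mul_nonneg hh hh]))
  linarith

lemma hx_congr_Efun {lam : ℝ} {f g : ℝ × ℝ → ℝ} (h : f =ᵐ[vP] g) : Efun lam f = Efun lam g := by
  have hG : Gop f = Gop g := by
    funext x
    unfold Gop
    apply integral_congr_ae
    filter_upwards [h] with y hy
    rw [hy]
  unfold Efun kineticE
  rw [hG]
  congr 2
  · apply integral_congr_ae
    filter_upwards [h] with y hy
    rw [hy]
  · apply integral_congr_ae
    filter_upwards [h] with y hy
    rw [hy]

lemma hx_lift {lam μ ν : ℝ} (hl : 0 < lam) {f : ℝ × ℝ → ℝ} (hf : Cls μ ν f) (hE : 0 < Efun lam f) :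
    ∃ g, InAdm μ ν g ∧ Efun lam f ≤ Efun lam g := by
  have hm0 : 0 ≤ ∫ x, f x ∂vP := integral_nonneg hf.fn.nn
  have hm : 0 < ∫ x, f x ∂vP := by
    rcases hm0.lt_or_eq with h | h
    · exact h
    · exfalso
      have h2 := (integral_eq_zero_iff_of_nonneg hf.fn.nn hf.fn.i1).mp h.symm
      have h3 : Efun lam f = Efun lam (fun _ => 0) := hx_congr_Efun h2
      rw [h3, hx_zero_Efun] at hE
      exact lt_irrefl _ hE
  obtain ⟨h, hh⟩ : ∃ h, h = (μ - ∫ x, x.2 * f x ∂vP) / ∫ x, f x ∂vP := ⟨_, rfl⟩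
  have h0 : 0 ≤ h := by rw [hh]; exact div_nonneg (by linarith [hf.im]) hm0
  let g : ℝ × ℝ → ℝ := fun x => UHP.indicator f (x - (0, h))
  have gz : ∀ x : ℝ × ℝ, x.2 ≤ h → g x = 0 := by
    intro x hx
    apply Set.indicator_of_notMem
    change ¬ (0 < x.2 - h)
    linarith
  have gT : ∀ x ∈ UHP, g (hxT h x) = f x := by
    intro x hx
    change UHP.indicator f (x + (0, h) - (0, h)) = f x
    rw [add_sub_cancel_right, Set.indicator_of_mem hx]
  have gT' : (fun x => g (hxT h x)) =ᵐ[vP] f := by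
    filter_upwards [hx_mem] with x hx using gT x hx
  have gn : ∀ x, 0 ≤ g x := fun x => Set.indicator_nonneg (fun y _ => hf.fn.nn y) _
  have gi1 : Integrable g vP := (hx_T_intg h0 gz).mpr (hf.fn.i1.congr gT'.symm)
  have z2 : ∀ x : ℝ × ℝ, x.2 ≤ h → (fun x => g x ^ 2) x = 0 := fun x hx => by simp [gz x hx]
  have e2 : (fun x => g (hxT h x) ^ 2) =ᵐ[vP] fun x => f x ^ 2 := by
    filter_upwards [gT'] with x hx
    rw [hx]
  have gi2 : Integrable (fun x => g x ^ 2) vP := (hx_T_intg h0 z2).mpr (hf.fn.i2.congr e2.symm)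
  have z3 : ∀ x : ℝ × ℝ, x.2 ≤ h → (fun x : ℝ × ℝ => x.2 * g x) x = 0 := fun x hx => by simp [gz x hx]
  have e3 : (fun x => (hxT h x).2 * g (hxT h x)) =ᵐ[vP] fun x => x.2 * f x + h * f x := by
    filter_upwards [gT'] with x hx
    rw [hx, ← add_mul]
    rfl
  have gi3 : Integrable (fun x => x.2 * g x) vP :=
    (hx_T_intg h0 z3).mpr ((hf.ii.add (hf.fn.i1.const_mul h)).congr e3.symm)
  have gF : Fn g := ⟨gn, gi1, gi2⟩
  have m1 : ∫ x, g x ∂vP = ∫ x, f x ∂vP := (hx_T_int h0 gz).trans (integral_congr_ae gT')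
  have m2 : ∫ x, g x ^ 2 ∂vP = ∫ x, f x ^ 2 ∂vP := (hx_T_int h0 z2).trans (integral_congr_ae e2)
  have m3 : ∫ x, x.2 * g x ∂vP = μ := by
    rw [hx_T_int h0 z3, integral_congr_ae e3, integral_add hf.ii (hf.fn.i1.const_mul h),
      integral_const_mul, hh]
    field_simp
    ring
  refine ⟨g, ⟨fun x _ => gn x, gi1, gi2, gi3, m3, (le_of_eq m1).trans hf.ma⟩, ?_⟩
  have hGop : ∀ x ∈ UHP, Gop f x ≤ Gop g (hxT h x) := by
    intro x hx
    have z4 : ∀ y : ℝ × ℝ, y.2 ≤ h → (fun y => GUHP (hxT h x) y * g y) y = 0 :=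
      fun y hy => by simp [gz y hy]
    have i4 := (hx_T_intg h0 z4).mp (hx_Gf_int gF (hx_T_mem h0 hx))
    have e4 : Gop g (hxT h x) = ∫ y, GUHP (hxT h x) (hxT h y) * g (hxT h y) ∂vP := hx_T_int h0 z4
    rw [e4]
    refine integral_mono_ae (hx_Gf_int hf.fn hx) i4 ?_
    filter_upwards [hx_mem] with y hy
    rw [gT y hy]
    exact mul_le_mul_of_nonneg_right (hx_T_GUHP h0 hx hy) (hf.fn.nn y)
  have z5 : ∀ y : ℝ × ℝ, y.2 ≤ h → (fun y => g y * Gop g y) y = 0 := fun y hy => by simp [gz y hy]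
  have i5 := (hx_T_intg h0 z5).mp (hx_fG_int gF)
  have e5 : ∫ x, f x * Gop f x ∂vP ≤ ∫ x, g x * Gop g x ∂vP := by
    rw [hx_T_int h0 z5]
    refine integral_mono_ae (hx_fG_int hf.fn) i5 ?_
    filter_upwards [hx_mem] with x hx
    rw [gT x hx]
    exact mul_le_mul_of_nonneg_left (hGop x hx) (hf.fn.nn x)
  have m2' : ∫ x in UHP, g x ^ 2 = ∫ x in UHP, f x ^ 2 := m2
  have e5' : ∫ x in UHP, f x * Gop f x ≤ ∫ x in UHP, g x * Gop g x := e5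
  unfold Efun kineticE
  rw [m2']
  linarith

lemma hx_adm_cls {μ ν : ℝ} {g : ℝ × ℝ → ℝ} (hg : InAdm μ ν g) :
    Cls μ ν (UHP.indicator g) ∧ UHP.indicator g =ᵐ[vP] g := by
  have e : UHP.indicator g =ᵐ[vP] g := by
    filter_upwards [hx_mem] with x hx
    exact Set.indicator_of_mem hx _
  obtain ⟨a1, a2, a3, a4, a5, a6⟩ := hg
  have e2 : (fun x => UHP.indicator g x ^ 2) =ᵐ[vP] fun x => g x ^ 2 := by
    filter_upwards [e] with x hx
    rw [hx]
  have e3 : (fun x : ℝ × ℝ => x.2 * UHP.indicator g x) =ᵐ[vP] fun x => x.2 * g x := by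
    filter_upwards [e] with x hx
    rw [hx]
  refine ⟨⟨⟨fun x => Set.indicator_nonneg a1 x, ?_, ?_⟩, ?_, ?_, ?_⟩, e⟩
  · exact Integrable.congr a2 e.symm
  · exact Integrable.congr a3 e2.symm
  · exact Integrable.congr a4 e3.symm
  · rw [integral_congr_ae e3]; exact a5.le
  · rw [integral_congr_ae e]; exact a6

theorem stmt6x (lam μ ν : ℝ) (hlam : 1 < lam) (hμ : 0 < μ) (hν : 0 < ν) :
    ∃ ω, InAdm μ ν ω ∧ Efun lam ω = Sval lam μ ν := by
  have hl : 0 < lam := by linarith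
  obtain ⟨f, hf, hmax⟩ := hx_relaxed hl hμ hν
  obtain ⟨g0, hg0, hp⟩ := hx_pos hlam hμ hν
  obtain ⟨g, hg, hfg⟩ := hx_lift hl hf (hp.trans_le (hmax g0 hg0))
  refine ⟨g, hg, ?_⟩
  have : IsGreatest {s | ∃ ω, InAdm μ ν ω ∧ s = Efun lam ω} (Efun lam g) := by
    refine ⟨⟨g, hg, rfl⟩, ?_⟩
    rintro s ⟨w, hw, rfl⟩
    obtain ⟨c, e⟩ := hx_adm_cls hw
    rw [← hx_congr_Efun e]
    exact (hmax _ c).trans hfg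
  exact this.csSup_eq.symm

/-- existence of a maximizer, `Σ_{μ,ν,λ} ≠ ∅`. -/
theorem stmt6 (lam μ ν : ℝ) (hlam : 1 < lam) (hμ : 0 < μ) (hν : 0 < ν)
    (h : μ * varrho lam ≤ ν) :
    ∃ ω : ℝ × ℝ → ℝ, InAdm μ ν ω ∧ Efun lam ω = Sval lam μ ν := by
  exact stmt6x lam μ ν hlam hμ hν
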